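/- arXiv:1109.2853 — 4 statements merged into one kernel-verified Lean document; each statement's English description precedes it below -/
import Mathlib

section
/- The effective Hamiltonian \overline{H} : ℝⁿ → ℝ is convex, continuous and coercive, i.e. \overline{H}(p) → +∞ as |p| → ∞. -/
open MeasureTheory Filter Metric Set
open scoped NNReal

noncomputable section

/-- ℝⁿ as a Euclidean space. -/
abbrev Ed (n : ℕ) := EuclideanSpace ℝ (Fin n)

/-- The admissible set of levels `μ` in the definition of the effective Hamiltonian. -/
def effSet {n : ℕ} (H : Ed n → Ed n → ℝ) (p : Ed n) : Set ℝ :=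
  {μ : ℝ | ∃ w : Ed n → ℝ,
    (∃ K : ℝ≥0, LipschitzWith K w) ∧
    Tendsto (fun y : Ed n => w y / ‖y‖) (cocompact (Ed n)) (nhds 0) ∧
    ∀ᵐ y ∂(volume : Measure (Ed n)), H (p + gradient w y) y ≤ μ}

/-- The effective Hamiltonian `H̄(p)`. -/
def effH {n : ℕ} (H : Ed n → Ed n → ℝ) (p : Ed n) : ℝ :=
  sInf (effSet H p)

/-- The average over long segments of the directional derivative of a strictly sublinear Lipschitz
function tends to zero, so an almost everywhere upper bound for that derivative is nonnegative. -/
lemma LipschitzWith.nonneg_of_ae_inner_gradient_le {n : ℕ} {w : Ed n → ℝ} {K : ℝ≥0}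
    (hw : LipschitzWith K w)
    (hsub : Tendsto (fun y : Ed n => w y / ‖y‖) (cocompact (Ed n)) (nhds 0))
    {v : Ed n} (hv : v ≠ 0) {c : ℝ}
    (hc : ∀ᵐ y ∂(volume : Measure (Ed n)), inner ℝ (gradient w y) v ≤ c) : 0 ≤ c := by
  obtain ⟨s, hs, hsm, hsp⟩ := (hw.ae_differentiableAt.and hc).exists_measurable_mem
  have hline := (ae_ae_add_linearMap_mem_iff (LinearMap.toSpanSingleton ℝ (Ed n) v)
    (volume : Measure ℝ) (volume : Measure (Ed n)) hsm).2 hs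
  obtain ⟨y, hy⟩ := hline.exists
  have hγ : ∀ t : ℝ, HasDerivAt (fun t : ℝ => y + t • v) v t := fun t => by
    simpa using ((hasDerivAt_id t).smul_const v).const_add y
  have hγL : LipschitzWith ‖v‖₊ (fun t : ℝ => y + t • v) := by
    refine LipschitzWith.of_dist_le_mul fun a b => ?_
    simp [dist_eq_norm, ← sub_smul, norm_smul, mul_comm]
  have hderiv : ∀ᵐ t : ℝ, deriv (fun t : ℝ => w (y + t • v)) t ≤ c := by
    filter_upwards [hy] with t ht
    obtain ⟨hd, hle⟩ := hsp _ ht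
    simp only [LinearMap.toSpanSingleton_apply] at hd hle
    have h := hd.hasFDerivAt.comp_hasDerivAt t (hγ t)
    rw [inner_gradient_left] at hle
    have h2 : deriv (fun t : ℝ => w (y + t • v)) t = fderiv ℝ w (y + t • v) v := h.deriv
    rwa [h2]
  have hbound : ∀ T : ℝ, 0 ≤ T → w (y + T • v) - w y ≤ T * c := by
    intro T hT
    have hac : AbsolutelyContinuousOnInterval (fun t : ℝ => w (y + t • v)) 0 T :=
      (hw.comp hγL).lipschitzOnWith.absolutelyContinuousOnInterval
    have hftc := hac.integral_deriv_eq_sub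
    have hmono := intervalIntegral.integral_mono_ae hT hac.intervalIntegrable_deriv
      (intervalIntegrable_const (c := c) (μ := volume)) hderiv
    rw [hftc] at hmono
    simpa using hmono
  have hnorm : Tendsto (fun T : ℝ => ‖y + T • v‖) atTop atTop := by
    refine tendsto_atTop_mono (f := fun T : ℝ => T * ‖v‖ - ‖y‖) (fun T => ?_)
      (tendsto_atTop_add_const_right _ _ (tendsto_id.atTop_mul_const (norm_pos_iff.2 hv)))
    have h1 : ‖T • v‖ ≤ ‖y + T • v‖ + ‖y‖ := by
      simpa using _root_.norm_sub_le (y + T • v) y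
    have h2 : T * ‖v‖ ≤ ‖T • v‖ := by
      rw [norm_smul]
      exact mul_le_mul_of_nonneg_right (le_abs_self T) (norm_nonneg v)
    linarith
  have hcoc : Tendsto (fun T : ℝ => y + T • v) atTop (cocompact (Ed n)) := by
    rw [← Metric.cobounded_eq_cocompact, ← comap_norm_atTop, tendsto_comap_iff]
    exact hnorm
  by_contra! hneg
  have hvpos := norm_pos_iff.2 hv
  have hε : 0 < -c / (4 * ‖v‖) := by
    apply div_pos <;> linarith
  have hev := (hsub.comp hcoc).eventually (lt_mem_nhds (neg_lt_zero.2 hε))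
  obtain ⟨T, hT, hT0, hTn, hTy, hTw⟩ := (hev.and ((eventually_gt_atTop (0 : ℝ)).and
    ((hnorm.eventually_gt_atTop 0).and ((eventually_ge_atTop (‖y‖ / ‖v‖)).and
      (eventually_gt_atTop (2 * w y / -c)))))).exists
  simp only [Function.comp_apply] at hT
  rw [lt_div_iff₀ hTn] at hT
  have hb := hbound T hT0.le
  rw [div_le_iff₀ hvpos] at hTy
  rw [div_lt_iff₀ (by linarith)] at hTw
  have hle : ‖y + T • v‖ ≤ 2 * T * ‖v‖ := by
    have h := norm_add_le y (T • v)
    rw [norm_smul, Real.norm_of_nonneg hT0.le] at h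
    linarith
  have hm : -c / (4 * ‖v‖) * ‖y + T • v‖ ≤ -c / (4 * ‖v‖) * (2 * T * ‖v‖) :=
    mul_le_mul_of_nonneg_left hle hε.le
  have he : -c / (4 * ‖v‖) * (2 * T * ‖v‖) = -c * T / 2 := by
    field_simp
    ring
  nlinarith

lemma bddBelow_effSet {n : ℕ} {H : Ed n → Ed n → ℝ} {m : ℝ} (hm : ∀ p y, m ≤ H p y) (p : Ed n) :
    BddBelow (effSet H p) := by
  refine ⟨m, ?_⟩
  rintro μ ⟨w, -, -, hw⟩
  obtain ⟨y, hy⟩ := hw.exists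
  exact (hm _ y).trans hy

lemma effSet_nonempty {n : ℕ} {H : Ed n → Ed n → ℝ} {p : Ed n} {C : ℝ} (hC : ∀ y, H p y ≤ C) :
    (effSet H p).Nonempty := by
  refine ⟨C, fun _ => 0, ⟨0, LipschitzWith.const 0⟩, by simpa using tendsto_const_nhds, Eventually.of_forall fun y => ?_⟩
  simpa [gradient_fun_const] using hC y

lemma smul_add_smul_mem_effSet {n : ℕ} {H : Ed n → Ed n → ℝ}
    (hconv : ∀ y, ConvexOn ℝ Set.univ (fun p => H p y)) {p q : Ed n} {μ ν a b : ℝ}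
    (hμ : μ ∈ effSet H p) (hν : ν ∈ effSet H q) (ha : 0 ≤ a) (hb : 0 ≤ b) (hab : a + b = 1) :
    a * μ + b * ν ∈ effSet H (a • p + b • q) := by
  obtain ⟨w, ⟨K, hK⟩, hw, hHw⟩ := hμ
  obtain ⟨z, ⟨L, hL⟩, hz, hHz⟩ := hν
  refine ⟨fun y => a • w y + b • z y,
    ⟨_, ((lipschitzWith_smul a).comp hK).add ((lipschitzWith_smul b).comp hL)⟩, ?_, ?_⟩
  · have h := (hw.const_mul a).add (hz.const_mul b)
    simp only [mul_zero, add_zero] at h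
    refine h.congr fun y => ?_
    simp only [smul_eq_mul]
    ring
  · filter_upwards [hHw, hHz, hK.ae_differentiableAt, hL.ae_differentiableAt] with y h1 h2 d1 d2
    have hg : gradient (fun y => a • w y + b • z y) y = a • gradient w y + b • gradient z y := by
      apply HasGradientAt.gradient
      rw [hasGradientAt_iff_hasFDerivAt]
      rw [map_add, map_smulₛₗ, map_smulₛₗ]
      exact (d1.hasGradientAt.hasFDerivAt.const_smul a).add
        (d2.hasGradientAt.hasFDerivAt.const_smul b)
    have hp : a • p + b • q + gradient (fun y => a • w y + b • z y) y =
        a • (p + gradient w y) + b • (q + gradient z y) := by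
      rw [hg]
      module
    rw [hp]
    calc H (a • (p + gradient w y) + b • (q + gradient z y)) y
        ≤ a • H (p + gradient w y) y + b • H (q + gradient z y) y :=
          (hconv y).2 (mem_univ _) (mem_univ _) ha hb hab
      _ ≤ a * μ + b * ν := by
          simp only [smul_eq_mul]
          gcongr

lemma le_of_mem_effSet {n : ℕ} {H : Ed n → Ed n → ℝ} {C R : ℝ}
    (hR : ∀ p y, R ≤ ‖p‖ → C ≤ H p y) {p : Ed n} (hp0 : p ≠ 0) (hp : R < ‖p‖) {μ : ℝ}
    (hμ : μ ∈ effSet H p) : C ≤ μ := by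
  obtain ⟨w, ⟨K, hK⟩, hw, hHw⟩ := hμ
  by_contra! hlt
  have hnonneg : 0 ≤ ‖p‖ * (R - ‖p‖) := by
    refine hK.nonneg_of_ae_inner_gradient_le hw hp0 ?_
    filter_upwards [hHw] with y hy
    have hn : ‖p + gradient w y‖ ≤ R := by
      by_contra! h
      linarith [hR _ y h.le]
    have h1 := real_inner_le_norm (p + gradient w y) p
    rw [inner_add_left, real_inner_self_eq_norm_sq] at h1
    nlinarith [norm_nonneg p]
  nlinarith [norm_pos_iff.2 hp0]

/-- The effective Hamiltonian is convex, continuous and coercive. -/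
theorem stmt_1
    (n : ℕ) (hn : 1 ≤ n)
    (H : Ed n → Ed n → ℝ)
    (hconv : ∀ y, ConvexOn ℝ Set.univ (fun p => H p y))
    (hcoer : ∀ C : ℝ, ∃ R : ℝ, ∀ p y, R ≤ ‖p‖ → C ≤ H p y)
    (hreg : ∀ R > (0 : ℝ),
      UniformContinuousOn (fun q : Ed n × Ed n => H q.1 q.2) (Metric.ball 0 R ×ˢ Set.univ) ∧
      ∃ C : ℝ, ∀ p y, ‖p‖ < R → |H p y| ≤ C) :
    ConvexOn ℝ Set.univ (effH H) ∧ Continuous (effH H) ∧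
      Tendsto (effH H) (cocompact (Ed n)) atTop := by
  have hne : ∀ p, (effSet H p).Nonempty := fun p => by
    obtain ⟨-, C, hC⟩ := hreg (‖p‖ + 1) (by positivity)
    exact effSet_nonempty fun y => (abs_le.1 (hC p y (by linarith))).2
  have hbdd : ∀ p, BddBelow (effSet H p) := by
    obtain ⟨R, hR⟩ := hcoer 0
    obtain ⟨-, C, hC⟩ := hreg (max R 1) (by positivity)
    refine bddBelow_effSet (m := min 0 (-C)) fun p y => ?_
    rcases lt_or_ge ‖p‖ (max R 1) with h | h
    · exact (min_le_right _ _).trans (abs_le.1 (hC p y h)).1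
    · exact (min_le_left _ _).trans (hR p y ((le_max_left _ _).trans h))
  have hcvx : ConvexOn ℝ Set.univ (effH H) := by
    refine ⟨convex_univ, fun p _ q _ a b ha hb hab => le_of_forall_pos_le_add fun ε hε => ?_⟩
    obtain ⟨μ, hμ, hμlt⟩ := Real.lt_sInf_add_pos (hne p) hε
    obtain ⟨ν, hν, hνlt⟩ := Real.lt_sInf_add_pos (hne q) hε
    calc effH H (a • p + b • q) ≤ a * μ + b * ν :=
          csInf_le (hbdd _) (smul_add_smul_mem_effSet hconv hμ hν ha hb hab)
      _ ≤ a * (effH H p + ε) + b * (effH H q + ε) := by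
          unfold effH
          gcongr
      _ = a • effH H p + b • effH H q + ε := by
          simp only [smul_eq_mul]
          linear_combination ε * hab
  refine ⟨hcvx, continuousOn_univ.1 (hcvx.continuousOn isOpen_univ), tendsto_atTop.2 fun C => ?_⟩
  obtain ⟨R, hR⟩ := hcoer C
  filter_upwards [(tendsto_norm_cocompact_atTop (E := Ed n)).eventually_gt_atTop (max R 0)]
    with p hp
  rw [max_lt_iff] at hp
  exact le_csInf (hne p) fun μ hμ => le_of_mem_effSet hR (norm_pos_iff.1 hp.2) hp.1 hμ

end
end

section
/- There exist a function \overline{H} : ℝⁿ → ℝ and an event Ω₁ ∈ F with P[Ω₁] = 1 such that \overline{H}(p,ω) = \overline{H}(p) for every p ∈ ℝⁿ and every ω ∈ Ω₁; that is, the random effective Hamiltonian is almost surely a deterministic function of p. -/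
open MeasureTheory Filter Metric Set
open scoped NNReal

noncomputable section

/-- The admissible set of levels `μ` in the definition of the random effective Hamiltonian
`H̄(p, ω)`: those `μ` for which there is a Lipschitz function `w`, strictly sublinear at
infinity, with `H (p + ∇w y) y ω ≤ μ` for a.e. `y`. -/
def effSetR {n : ℕ} {Ω : Type*} (H : Ed n → Ed n → Ω → ℝ) (ω : Ω) (p : Ed n) : Set ℝ :=
  {μ : ℝ | ∃ w : Ed n → ℝ,
    (∃ K : ℝ≥0, LipschitzWith K w) ∧
    Tendsto (fun y : Ed n => w y / ‖y‖) (cocompact (Ed n)) (nhds 0) ∧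
    ∀ᵐ y ∂(volume : Measure (Ed n)), H (p + gradient w y) y ω ≤ μ}

/-- The random effective Hamiltonian `H̄(p, ω)`. -/
def effHR {n : ℕ} {Ω : Type*} (H : Ed n → Ed n → Ω → ℝ) (ω : Ω) (p : Ed n) : ℝ :=
  sInf (effSetR H ω p)

/-- Existence of a point of a compact separable space satisfying countably many closed
constraints that depend measurably on a parameter is a measurable event. -/
theorem measurableSet_exists_forall_le {Ω X ι : Type*} [MeasurableSpace Ω] [TopologicalSpace X]
    [CompactSpace X] [TopologicalSpace.SeparableSpace X] [Countable ι] (Φ : ι → Ω → X → ℝ)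
    (hm : ∀ i x, Measurable fun ω => Φ i ω x) (hc : ∀ i ω, Continuous (Φ i ω)) :
    MeasurableSet {ω | ∃ x, ∀ i, Φ i ω x ≤ 0} := by
  obtain ⟨D, hDc, hDd⟩ := TopologicalSpace.exists_countable_dense X
  have key : {ω | ∃ x, ∀ i, Φ i ω x ≤ 0} =
      ⋂ t : Finset (ι × ℕ), ⋃ d ∈ D, ⋂ q ∈ t, {ω | Φ q.1 ω d < 1 / ((q.2 : ℝ) + 1)} := by
    ext ω
    simp only [mem_ofPred_eq, mem_iInter, mem_iUnion, exists_prop]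
    constructor
    · rintro ⟨x, hx⟩ t
      have hopen : IsOpen (⋂ q ∈ t, {y | Φ q.1 ω y < 1 / ((q.2 : ℝ) + 1)}) :=
        isOpen_biInter_finset fun q _ => isOpen_lt (hc q.1 ω) continuous_const
      obtain ⟨d, hd, hdD⟩ := hDd.inter_open_nonempty _ hopen
        ⟨x, by
          simp only [mem_iInter, mem_ofPred_eq]
          exact fun q _ => (hx q.1).trans_lt (by positivity)⟩
      simp only [mem_iInter, mem_ofPred_eq] at hd
      exact ⟨d, hdD, hd⟩
    · intro h
      obtain ⟨x, hx⟩ := CompactSpace.iInter_nonempty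
        (t := fun q : ι × ℕ => {y | Φ q.1 ω y ≤ 1 / ((q.2 : ℝ) + 1)})
        (fun q => isClosed_le (hc q.1 ω) continuous_const) (fun t => by
          obtain ⟨d, -, hd⟩ := h t
          exact ⟨d, by
            simp only [mem_iInter, mem_ofPred_eq]
            exact fun q hq => (hd q hq).le⟩)
      simp only [mem_iInter, mem_ofPred_eq] at hx
      exact ⟨x, fun i => ge_of_tendsto' tendsto_one_div_add_atTop_nhds_zero_nat
        fun k => hx (i, k)⟩
  rw [key]
  exact MeasurableSet.iInter fun t => MeasurableSet.biUnion hDc fun d _ =>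
    Finset.measurableSet_biInter t fun q _ => measurableSet_lt (hm q.1 d) measurable_const

/-- A capacitability argument: an event described by the existence of a point `x` in a compact
space such that for each `j` there is `r` with `x ∈ C j r` can be approximated from inside, with
respect to the outer measure, by fixing all the `r` in advance. -/
theorem exists_seq_le_measure {Ω X : Type*} [MeasurableSpace Ω] [TopologicalSpace X]
    [CompactSpace X] (P : Measure Ω) [IsFiniteMeasure P] (S : Ω → Set X)
    (hS : ∀ ω, IsClosed (S ω)) (C : ℕ → ℕ → Set X) (hC : ∀ j r, IsClosed (C j r))
    (hmono : ∀ j, Monotone (C j))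
    (hmeas : ∀ (R : ℕ → ℕ) (k : ℕ), MeasurableSet {ω | ∃ x ∈ S ω, ∀ j < k, x ∈ C j (R j)})
    {c : ENNReal} (hc : c < P {ω | ∃ x ∈ S ω, ∀ j, ∃ r, x ∈ C j r}) :
    ∃ R : ℕ → ℕ, c ≤ P {ω | ∃ x ∈ S ω, ∀ j, x ∈ C j (R j)} := by
  let D : Set X → Set Ω := fun T => {ω | ∃ x ∈ S ω, x ∈ T ∧ ∀ j, ∃ r, x ∈ C j r}
  have step : ∀ (k : ℕ) (T : {T : Set X // c < P (D T)}), ∃ r, c < P (D (T.1 ∩ C k r)) := by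
    rintro k ⟨T, hT⟩
    have hU : D T = ⋃ r, D (T ∩ C k r) := by
      ext ω
      simp only [D, mem_ofPred_eq, mem_iUnion]
      constructor
      · rintro ⟨x, hx, hxT, h⟩
        obtain ⟨r, hr⟩ := h k
        exact ⟨r, x, hx, ⟨hxT, hr⟩, h⟩
      · rintro ⟨r, x, hx, hxT, h⟩
        exact ⟨x, hx, hxT.1, h⟩
    have hM : Monotone fun r => D (T ∩ C k r) := by
      rintro a b hab ω ⟨x, hx, hxT, h⟩
      exact ⟨x, hx, ⟨hxT.1, hmono k hab hxT.2⟩, h⟩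
    rw [hU, hM.measure_iUnion] at hT
    exact lt_iSup_iff.1 hT
  choose f hf using step
  let T : ℕ → {T : Set X // c < P (D T)} := fun k =>
    Nat.rec ⟨univ, by simpa [D] using hc⟩ (fun k T => ⟨T.1 ∩ C k (f k T), hf k T⟩) k
  let R : ℕ → ℕ := fun k => f k (T k)
  have hT : ∀ k x, x ∈ (T k).1 → ∀ j < k, x ∈ C j (R j) := by
    intro k
    induction k with
    | zero => intro x _ j hj; omega
    | succ k ih =>
      intro x hx j hj
      rcases Nat.lt_succ_iff_lt_or_eq.1 hj with h | rfl
      · exact ih x hx.1 j h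
      · exact hx.2
  refine ⟨R, ?_⟩
  let E : ℕ → Set Ω := fun k => {ω | ∃ x ∈ S ω, ∀ j < k, x ∈ C j (R j)}
  have hE : ∀ k, c ≤ P (E k) := fun k => (T k).2.le.trans <| measure_mono <| by
    rintro ω ⟨x, hx, hxT, -⟩
    exact ⟨x, hx, hT k x hxT⟩
  have hanti : Antitone E := by
    rintro a b hab ω ⟨x, hx, h⟩
    exact ⟨x, hx, fun j hj => h j (hj.trans_le hab)⟩
  have hI : {ω | ∃ x ∈ S ω, ∀ j, x ∈ C j (R j)} = ⋂ k, E k := by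
    ext ω
    simp only [mem_ofPred_eq, mem_iInter, E]
    constructor
    · rintro ⟨x, hx, h⟩ k
      exact ⟨x, hx, fun j _ => h j⟩
    · intro h
      let Z : ℕ → Set X := fun k => S ω ∩ ⋂ j, ⋂ (_ : j < k), C j (R j)
      have hZ : ∀ k, IsClosed (Z k) := fun k =>
        (hS ω).inter (isClosed_iInter fun j => isClosed_iInter fun _ => hC _ _)
      obtain ⟨x, hx⟩ := IsCompact.nonempty_iInter_of_sequence_nonempty_isCompact_isClosed Z
        (fun k x hx => ⟨hx.1, mem_iInter₂.2 fun j hj => mem_iInter₂.1 hx.2 j (by omega)⟩)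
        (fun k => by
          obtain ⟨x, hx, hj⟩ := h k
          exact ⟨x, hx, mem_iInter₂.2 hj⟩)
        (hZ 0).isCompact hZ
      rw [mem_iInter] at hx
      exact ⟨x, (hx 0).1, fun j => mem_iInter₂.1 (hx (j + 1)).2 j (by omega)⟩
  rw [hI, hanti.measure_iInter (fun k => (hmeas R k).nullMeasurableSet) ⟨0, measure_ne_top _ _⟩]
  exact le_iInf hE

/-- The `K`-Lipschitz functions on `ℝⁿ` bounded by `‖y‖ + K`. -/
def lipFamily (n : ℕ) (K : ℝ≥0) : Set C(Ed n, ℝ) :=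
  {w | LipschitzWith K w ∧ ∀ y, |w y| ≤ ‖y‖ + K}

theorem isCompact_lipFamily (n : ℕ) (K : ℝ≥0) : IsCompact (lipFamily n K) := by
  apply ArzelaAscoli.isCompact_of_equicontinuous
  · have himg : ContinuousMap.toFun '' lipFamily n K =
        {f : Ed n → ℝ | LipschitzWith K f} ∩
          Set.pi univ fun y => Icc (-(‖y‖ + (K : ℝ))) (‖y‖ + K) := by
      ext f
      simp only [mem_image, mem_inter_iff, mem_ofPred_eq, Set.mem_pi, mem_univ, true_imp_iff, mem_Icc]
      constructor
      · rintro ⟨w, hw, rfl⟩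
        exact ⟨hw.1, fun y => abs_le.1 (hw.2 y)⟩
      · rintro ⟨h1, h2⟩
        exact ⟨⟨f, h1.continuous⟩, ⟨h1, fun y => abs_le.2 (h2 y)⟩, rfl⟩
    rw [himg]
    refine (isCompact_univ_pi fun y => isCompact_Icc).inter_left ?_
    simp only [lipschitzWith_iff_dist_le_mul, ofPred_forall]
    exact isClosed_iInter fun x => isClosed_iInter fun y =>
      isClosed_le ((continuous_apply x).dist (continuous_apply y)) continuous_const
  · exact (LipschitzWith.uniformEquicontinuous _ K fun w => w.2.1).equicontinuous

instance (n : ℕ) (K : ℝ≥0) : CompactSpace (lipFamily n K) :=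
  isCompact_iff_compactSpace.1 (isCompact_lipFamily n K)

theorem norm_gradient_le_of_lipschitz {n : ℕ} {K : ℝ≥0} {w : Ed n → ℝ} (hw : LipschitzWith K w)
    (y : Ed n) : ‖gradient w y‖ ≤ K := by
  rw [gradient, LinearIsometryEquiv.norm_map]
  exact norm_fderiv_le_of_lipschitz ℝ hw

theorem measurable_gradient {n : ℕ} (w : Ed n → ℝ) : Measurable (gradient w) :=
  (InnerProductSpace.toDual ℝ (Ed n)).symm.continuous.measurable.comp (measurable_fderiv ℝ w)

theorem locallyIntegrable_gradient {n : ℕ} {K : ℝ≥0} {w : Ed n → ℝ} (hw : LipschitzWith K w) :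
    LocallyIntegrable (gradient w) (volume : Measure (Ed n)) :=
  (locallyIntegrable_const (K : ℝ)).mono (measurable_gradient w).aestronglyMeasurable <|
    Eventually.of_forall fun y => by
      simpa using norm_gradient_le_of_lipschitz hw y

theorem continuous_integral_smul_gradient {n : ℕ} (K : ℝ≥0) {ψ : Ed n → ℝ}
    (hψ : ContDiff ℝ 1 ψ) (hψc : HasCompactSupport ψ) :
    Continuous fun w : lipFamily n K => ∫ x, ψ x • gradient w.1 x := by
  obtain ⟨D, hD⟩ := hψ.lipschitzWith_of_hasCompactSupport hψc one_ne_zero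
  have hcoord : ∀ i, Continuous fun w : lipFamily n K => (∫ x, ψ x • gradient w.1 x) i := by
    intro i
    let e : Ed n := EuclideanSpace.single i 1
    have hcont : Continuous fun x => fderiv ℝ ψ x (-e) :=
      (hψ.continuous_fderiv one_ne_zero).clm_apply continuous_const
    have heq : ∀ w : lipFamily n K, (∫ x, ψ x • gradient w.1 x) i =
        ∫ x in tsupport ψ, fderiv ℝ ψ x (-e) * w.1 x := by
      intro w
      have hint : Integrable (fun x => ψ x • gradient w.1 x) :=
        (locallyIntegrable_gradient w.2.1).integrable_smul_left_of_hasCompactSupport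
          hψ.continuous hψc
      have h1 : (∫ x, ψ x • gradient w.1 x) i = inner ℝ e (∫ x, ψ x • gradient w.1 x) := by
        simp [e, EuclideanSpace.inner_single_left]
      rw [h1, ← integral_inner hint]
      have h2 : ∫ x, inner ℝ e (ψ x • gradient w.1 x) = ∫ x, lineDeriv ℝ w.1 x e * ψ x := by
        apply integral_congr_ae
        filter_upwards [w.2.1.ae_differentiableAt] with x hx
        rw [hx.lineDeriv_eq_fderiv, inner_smul_right, real_inner_comm, mul_comm, gradient,
          InnerProductSpace.toDual_symm_apply]
      rw [h2, w.2.1.integral_lineDeriv_mul_eq hD hψc]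
      have h3 : ∀ x, lineDeriv ℝ ψ x (-e) = fderiv ℝ ψ x (-e) := fun x =>
        (hψ.differentiable one_ne_zero x).lineDeriv_eq_fderiv
      simp only [h3]
      symm
      apply setIntegral_eq_integral_of_forall_compl_eq_zero
      intro x hx
      have : fderiv ℝ ψ x = 0 := by
        by_contra h
        exact hx (support_fderiv_subset ℝ h)
      simp [this]
    simp only [heq]
    apply continuous_parametric_integral_of_continuous _ hψc
    exact (hcont.comp continuous_snd).mul
      (((continuous_subtype_val.comp continuous_fst)).eval continuous_snd)
  have := (PiLp.continuous_toLp 2 (fun _ : Fin n => ℝ)).comp (continuous_pi hcoord)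
  exact this

theorem mollified_gradient_mem {n : ℕ} {K : ℝ≥0} {w : Ed n → ℝ} (hw : LipschitzWith K w)
    (φ : ContDiffBump (0 : Ed n)) (y : Ed n) {s : Set (Ed n)} (hs : Convex ℝ s)
    (hsc : IsClosed s) (p : Ed n)
    (h : ∀ᵐ x, dist x y < φ.rOut → p + gradient w x ∈ s) :
    p + ∫ x, φ.normed volume (y - x) • gradient w x ∈ s := by
  let f : Ed n → ℝ≥0 := fun x => (φ.normed volume (y - x)).toNNReal
  have hnn : ∀ x, 0 ≤ φ.normed volume (y - x) := fun x => φ.nonneg_normed _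
  have hcont : Continuous fun x => φ.normed volume (y - x) :=
    φ.continuous_normed.comp (continuous_const.sub continuous_id)
  have hfm : Measurable f := hcont.measurable.real_toNNReal
  have hint1 : ∫ x, φ.normed volume (y - x) = 1 := by
    rw [integral_sub_left_eq_self (fun x => φ.normed (volume : Measure (Ed n)) x) volume y]
    exact φ.integral_normed
  have hInt : Integrable fun x => φ.normed volume (y - x) := by
    by_contra hcon
    rw [integral_undef hcon] at hint1
    exact zero_ne_one hint1
  let ν : Measure (Ed n) := volume.withDensity fun x => (f x : ENNReal)
  have hprob : IsProbabilityMeasure ν := ⟨by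
    rw [withDensity_apply _ MeasurableSet.univ, Measure.restrict_univ]
    have : ∀ x, (f x : ENNReal) = ENNReal.ofReal (φ.normed volume (y - x)) := fun x => rfl
    simp only [this]
    rw [← ofReal_integral_eq_lintegral_ofReal hInt (Eventually.of_forall hnn), hint1,
      ENNReal.ofReal_one]⟩
  have hsm : ∀ x, f x • gradient w x = φ.normed volume (y - x) • gradient w x := fun x => by
    rw [NNReal.smul_def, Real.coe_toNNReal _ (hnn x)]
  have hgi : Integrable (gradient w) ν := by
    refine Integrable.mono' (integrable_const (K : ℝ))
      (measurable_gradient w).aestronglyMeasurable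
      (Eventually.of_forall fun x => norm_gradient_le_of_lipschitz hw x)
  have hmem := hs.integral_mem (μ := ν) hsc (f := fun x => p + gradient w x) (by
    rw [ae_withDensity_iff hfm.coe_nnreal_ennreal]
    filter_upwards [h] with x hx hfx
    apply hx
    have h0 : φ.normed volume (y - x) ≠ 0 := by
      intro h0
      simp [f, h0] at hfx
    have : y - x ∈ Function.support (φ.normed (volume : Measure (Ed n))) := h0
    rw [φ.support_normed_eq, mem_ball_zero_iff] at this
    rwa [dist_comm, dist_eq_norm]) ((integrable_const p).add hgi)
  rw [integral_add (integrable_const p) hgi, integral_const, probReal_univ, one_smul,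
    integral_withDensity_eq_integral_smul hfm] at hmem
  simpa only [hsm] using hmem

theorem continuous_uncurry_of_equicontinuous {n : ℕ} {h : Ed n → Ed n → ℝ}
    (hequi : ∀ R > (0 : ℝ), ∀ ε > (0 : ℝ), ∃ δ > (0 : ℝ), ∀ p₁ p₂ y₁ y₂ : Ed n,
      ‖p₁‖ < R → ‖p₂‖ < R → dist p₁ p₂ < δ → dist y₁ y₂ < δ → |h p₁ y₁ - h p₂ y₂| ≤ ε) :
    Continuous fun q : Ed n × Ed n => h q.1 q.2 := by
  rw [Metric.continuous_iff]
  rintro ⟨p, y⟩ ε hε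
  obtain ⟨δ, hδ, hh⟩ := hequi (‖p‖ + 1) (by positivity) (ε / 2) (by positivity)
  refine ⟨min δ 1, by positivity, ?_⟩
  rintro ⟨q, x⟩ hqx
  rw [Prod.dist_eq, max_lt_iff, lt_min_iff, lt_min_iff] at hqx
  have hq : ‖q‖ < ‖p‖ + 1 := by
    have := norm_le_norm_add_norm_sub' q p
    rw [← dist_eq_norm] at this
    linarith [hqx.1.2]
  rw [Real.dist_eq]
  have := hh q p x y hq (by linarith) hqx.1.1 hqx.2.1
  change |h q x - h p y| < ε
  linarith

/-- For a Lipschitz function, being an almost everywhere subsolution is equivalent to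
countably many inequalities for its mollifications. -/
theorem ae_subsolution_iff {n : ℕ} {K : ℝ≥0} {w : Ed n → ℝ} (hw : LipschitzWith K w)
    {h : Ed n → Ed n → ℝ} (hcont : Continuous fun q : Ed n × Ed n => h q.1 q.2)
    (hconv : ∀ y, ConvexOn ℝ univ fun p => h p y) (p : Ed n) (μ : ℝ)
    (φ : ℕ → ContDiffBump (0 : Ed n)) (hφ : ∀ m, (φ m).rOut ≤ 1 / ((m : ℝ) + 1))
    (hφ' : ∀ m, (φ m).rOut = 2 * (φ m).rIn)
    (hosc : ∀ m q y₁ y₂, ‖q‖ ≤ ‖p‖ + K → dist y₁ y₂ < (φ m).rOut →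
      |h q y₁ - h q y₂| ≤ 1 / ((m : ℝ) + 1)) :
    (∀ᵐ y, h (p + gradient w y) y ≤ μ) ↔ ∀ m k : ℕ,
      h (p + ∫ x, (φ m).normed volume (TopologicalSpace.denseSeq (Ed n) k - x) • gradient w x)
        (TopologicalSpace.denseSeq (Ed n) k) - μ - 1 / ((m : ℝ) + 1) ≤ 0 := by
  constructor
  · intro hsub m k
    set y := TopologicalSpace.denseSeq (Ed n) k
    have hs : Convex ℝ {q | h q y ≤ μ + 1 / ((m : ℝ) + 1)} := by
      simpa using (hconv y).convex_le (μ + 1 / ((m : ℝ) + 1))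
    have hsc : IsClosed {q | h q y ≤ μ + 1 / ((m : ℝ) + 1)} :=
      isClosed_le (hcont.comp (continuous_id.prodMk continuous_const)) continuous_const
    have := mollified_gradient_mem hw (φ m) y hs hsc p (by
      filter_upwards [hsub] with x hx hd
      have hn : ‖p + gradient w x‖ ≤ ‖p‖ + K :=
        (norm_add_le _ _).trans (by gcongr; exact norm_gradient_le_of_lipschitz hw x)
      have := abs_le.1 (hosc m _ x y hn hd)
      change h (p + gradient w x) y ≤ _
      linarith [this.1])
    have : h _ y ≤ _ := this
    linarith
  · intro hall
    have hconvol : ∀ m y, ∫ x, (φ m).normed volume (y - x) • gradient w x =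
        (convolution ((φ m).normed volume) (gradient w) (ContinuousLinearMap.lsmul ℝ ℝ)
          volume) y := by
      intro m y
      rw [convolution_eq_swap]
      simp
    have hcm : ∀ m, Continuous fun y => ∫ x, (φ m).normed volume (y - x) • gradient w x := by
      intro m
      simp only [hconvol]
      exact (φ m).hasCompactSupport_normed.continuous_convolution_left _
        (φ m).continuous_normed (locallyIntegrable_gradient hw)
    have hall' : ∀ m y, h (p + ∫ x, (φ m).normed volume (y - x) • gradient w x) y ≤
        μ + 1 / ((m : ℝ) + 1) := by
      intro m y
      have hcl : IsClosed {y | h (p + ∫ x, (φ m).normed volume (y - x) • gradient w x) y ≤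
          μ + 1 / ((m : ℝ) + 1)} :=
        isClosed_le (hcont.comp ((continuous_const.add (hcm m)).prodMk continuous_id))
          continuous_const
      have hsub : range (TopologicalSpace.denseSeq (Ed n)) ⊆
          {y | h (p + ∫ x, (φ m).normed volume (y - x) • gradient w x) y ≤
            μ + 1 / ((m : ℝ) + 1)} := by
        rintro _ ⟨k, rfl⟩
        have := hall m k
        change h _ _ ≤ _
        linarith
      exact hcl.closure_subset_iff.2 hsub (TopologicalSpace.denseRange_denseSeq _ y)
    have hr : Tendsto (fun m => (φ m).rOut) atTop (nhds 0) :=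
      squeeze_zero (fun m => (φ m).rOut_pos.le) hφ tendsto_one_div_add_atTop_nhds_zero_nat
    filter_upwards [ContDiffBump.ae_convolution_tendsto_right_of_locallyIntegrable
      (μ := volume) (K := 2) hr (Eventually.of_forall fun m => (hφ' m).le)
      (locallyIntegrable_gradient hw)] with y hy
    simp only [← hconvol] at hy
    have h1 : Tendsto (fun m => h (p + ∫ x, (φ m).normed volume (y - x) • gradient w x) y)
        atTop (nhds (h (p + gradient w y) y)) := by
      have hc : Continuous fun q => h (p + q) y :=
        hcont.comp ((continuous_const.add continuous_id).prodMk continuous_const)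
      exact (hc.tendsto _).comp hy
    have h2 : Tendsto (fun m : ℕ => μ + 1 / ((m : ℝ) + 1)) atTop (nhds μ) := by
      simpa using (tendsto_const_nhds (x := μ)).add
        (tendsto_one_div_add_atTop_nhds_zero_nat (𝕜 := ℝ))
    exact le_of_tendsto_of_tendsto' h1 h2 fun m => hall' m y

/-- The subsolution property at level `μ` within a Lipschitz family is given by countably many
closed constraints depending measurably on the environment. -/
theorem exists_subsolution_constraints {n : ℕ} {Ω : Type*} [MeasurableSpace Ω]
    (H : Ed n → Ed n → Ω → ℝ)
    (hHmeas : ∀ p, Measurable (fun q : Ed n × Ω => H p q.1 q.2))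
    (hHconv : ∀ y ω, ConvexOn ℝ Set.univ (fun p => H p y ω))
    (hHequi : ∀ R > (0 : ℝ), ∀ ε > (0 : ℝ), ∃ δ > (0 : ℝ), ∀ (ω : Ω) (p₁ p₂ y₁ y₂ : Ed n),
      ‖p₁‖ < R → ‖p₂‖ < R → dist p₁ p₂ < δ → dist y₁ y₂ < δ →
      |H p₁ y₁ ω - H p₂ y₂ ω| ≤ ε) (p : Ed n) (μ : ℝ) (K : ℝ≥0) :
    ∃ Φ : ℕ × ℕ → Ω → lipFamily n K → ℝ, (∀ i w, Measurable fun ω => Φ i ω w) ∧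
      (∀ i ω, Continuous (Φ i ω)) ∧
      ∀ ω (w : lipFamily n K),
        (∀ᵐ y, H (p + gradient w.1 y) y ω ≤ μ) ↔ ∀ i, Φ i ω w ≤ 0 := by
  have hR : 0 < ‖p‖ + K + 1 := by positivity
  choose δ hδ hδH using fun m : ℕ => hHequi (‖p‖ + K + 1) hR (1 / ((m : ℝ) + 1)) (by positivity)
  let r : ℕ → ℝ := fun m => min (δ m) (1 / ((m : ℝ) + 1))
  have hr : ∀ m, 0 < r m := fun m => lt_min (hδ m) (by positivity)
  let φ : ℕ → ContDiffBump (0 : Ed n) := fun m =>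
    ⟨r m / 2, r m, half_pos (hr m), half_lt_self (hr m)⟩
  have hcont : ∀ ω, Continuous fun q : Ed n × Ed n => H q.1 q.2 ω := fun ω =>
    continuous_uncurry_of_equicontinuous (h := fun p y => H p y ω) fun R hR ε hε => by
      obtain ⟨δ, hδ, h⟩ := hHequi R hR ε hε
      exact ⟨δ, hδ, h ω⟩
  refine ⟨fun i ω w => H (p + ∫ x, (φ i.1).normed volume
      (TopologicalSpace.denseSeq (Ed n) i.2 - x) • gradient w.1 x)
        (TopologicalSpace.denseSeq (Ed n) i.2) ω - μ - 1 / ((i.1 : ℝ) + 1), ?_, ?_, ?_⟩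
  · intro i w
    exact (((hHmeas _).comp measurable_prodMk_left).sub_const _).sub_const _
  · intro i ω
    refine (((hcont ω).comp (Continuous.prodMk (continuous_const.add ?_)
      continuous_const)).sub continuous_const).sub continuous_const
    refine continuous_integral_smul_gradient K (ψ := fun x => (φ i.1).normed volume
      (TopologicalSpace.denseSeq (Ed n) i.2 - x)) ?_ ?_
    · exact (φ i.1).contDiff_normed.comp (contDiff_const.sub contDiff_id)
    · exact (φ i.1).hasCompactSupport_normed.comp_homeomorph
        (Homeomorph.subLeft (TopologicalSpace.denseSeq (Ed n) i.2))
  · intro ω w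
    rw [ae_subsolution_iff w.2.1 (h := fun q y => H q y ω) (hcont ω) (fun y => hHconv y ω) p μ φ
      (fun m => min_le_right _ _) (fun m => by simp only [φ]; ring)
      (fun m q y₁ y₂ hq hd => hδH m ω q q y₁ y₂ (by linarith) (by linarith)
        (by simpa using hδ m) (hd.trans_le (min_le_left _ _)))]
    exact ⟨fun h i => h i.1 i.2, fun h m k => h (m, k)⟩

/-- The functions of a Lipschitz family which grow at most like `‖y‖ / (j + 1) + r`. -/
def growthSet (n : ℕ) (K : ℝ≥0) (j r : ℕ) : Set (lipFamily n K) :=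
  {w | ∀ y, |w.1 y| ≤ ‖y‖ / ((j : ℝ) + 1) + r}

theorem monotone_growthSet (n : ℕ) (K : ℝ≥0) (j : ℕ) : Monotone (growthSet n K j) := by
  intro a b hab w hw y
  exact (hw y).trans (by gcongr)

theorem continuous_eval_lipFamily (n : ℕ) (K : ℝ≥0) (y : Ed n) :
    Continuous fun w : lipFamily n K => w.1 y :=
  (ContinuousEvalConst.continuous_eval_const y).comp continuous_subtype_val

theorem isClosed_growthSet (n : ℕ) (K : ℝ≥0) (j r : ℕ) : IsClosed (growthSet n K j r) := by
  simp only [growthSet, ofPred_forall]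
  exact isClosed_iInter fun y =>
    isClosed_le (continuous_eval_lipFamily n K y).abs continuous_const

theorem mem_growthSet_iff_denseSeq {n : ℕ} {K : ℝ≥0} {j r : ℕ} {w : lipFamily n K} :
    w ∈ growthSet n K j r ↔ ∀ k, |w.1 (TopologicalSpace.denseSeq (Ed n) k)| -
      (‖TopologicalSpace.denseSeq (Ed n) k‖ / ((j : ℝ) + 1) + r) ≤ 0 := by
  constructor
  · intro h k
    exact sub_nonpos.2 (h _)
  · intro h y
    have hcl : IsClosed {y | |w.1 y| ≤ ‖y‖ / ((j : ℝ) + 1) + r} :=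
      isClosed_le w.1.continuous.abs ((continuous_norm.div_const _).add continuous_const)
    refine hcl.closure_subset_iff.2 ?_ (TopologicalSpace.denseRange_denseSeq _ y)
    rintro _ ⟨k, rfl⟩
    exact sub_nonpos.1 (h k)

theorem measurableSet_exists_subsolution {n : ℕ} {Ω : Type*} [MeasurableSpace Ω]
    (H : Ed n → Ed n → Ω → ℝ)
    (hHmeas : ∀ p, Measurable (fun q : Ed n × Ω => H p q.1 q.2))
    (hHconv : ∀ y ω, ConvexOn ℝ Set.univ (fun p => H p y ω))
    (hHequi : ∀ R > (0 : ℝ), ∀ ε > (0 : ℝ), ∃ δ > (0 : ℝ), ∀ (ω : Ω) (p₁ p₂ y₁ y₂ : Ed n),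
      ‖p₁‖ < R → ‖p₂‖ < R → dist p₁ p₂ < δ → dist y₁ y₂ < δ →
      |H p₁ y₁ ω - H p₂ y₂ ω| ≤ ε) (p : Ed n) (μ : ℝ) (K : ℝ≥0) (A : Set ℕ) (R : ℕ → ℕ) :
    MeasurableSet {ω | ∃ w : lipFamily n K, (∀ᵐ y, H (p + gradient w.1 y) y ω ≤ μ) ∧
      ∀ j ∈ A, w ∈ growthSet n K j (R j)} := by
  classical
  obtain ⟨Φ, hΦm, hΦc, hΦ⟩ :=
    exists_subsolution_constraints H hHmeas hHconv hHequi p μ K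
  let Ψ : (ℕ × ℕ) ⊕ (ℕ × ℕ) → Ω → lipFamily n K → ℝ := fun i ω w =>
    i.elim (fun a => Φ a ω w) fun a => if a.1 ∈ A then
      |w.1 (TopologicalSpace.denseSeq (Ed n) a.2)| -
        (‖TopologicalSpace.denseSeq (Ed n) a.2‖ / ((a.1 : ℝ) + 1) + R a.1) else 0
  have hset : {ω | ∃ w : lipFamily n K, (∀ᵐ y, H (p + gradient w.1 y) y ω ≤ μ) ∧
      ∀ j ∈ A, w ∈ growthSet n K j (R j)} = {ω | ∃ w, ∀ i, Ψ i ω w ≤ 0} := by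
    ext ω
    refine exists_congr fun w => ?_
    rw [hΦ, Sum.forall]
    refine and_congr Iff.rfl ?_
    simp only [mem_growthSet_iff_denseSeq]
    constructor
    · rintro h ⟨j, k⟩
      by_cases hj : j ∈ A
      · simpa [Ψ, hj] using h j hj k
      · simp [Ψ, hj]
    · intro h j hj k
      simpa [Ψ, hj] using h (j, k)
  rw [hset]
  apply measurableSet_exists_forall_le
  · rintro (i | i) w
    · exact hΦm i w
    · exact measurable_const
  · rintro (i | i) ω
    · exact hΦc i ω
    · by_cases hi : i.1 ∈ A
      · simp only [Ψ, Sum.elim_inr, hi, if_true]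
        exact (continuous_eval_lipFamily n K _).abs.sub continuous_const
      · simp only [Ψ, Sum.elim_inr, hi, if_false]
        exact continuous_const

theorem tendsto_div_norm_iff_growth {n : ℕ} {w : Ed n → ℝ} (hw : Continuous w) :
    Tendsto (fun y : Ed n => w y / ‖y‖) (cocompact (Ed n)) (nhds 0) ↔
      ∀ j : ℕ, ∃ r : ℕ, ∀ y, |w y| ≤ ‖y‖ / ((j : ℝ) + 1) + r := by
  constructor
  · intro h j
    have h1 : ∀ᶠ y in cocompact (Ed n), |w y / ‖y‖| < 1 / ((j : ℝ) + 1) := by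
      simpa only [Real.dist_eq, sub_zero] using (Metric.tendsto_nhds.1 h) (1 / ((j : ℝ) + 1)) (by positivity)
    obtain ⟨A, hA, hAc⟩ := mem_cocompact.1 h1
    obtain ⟨M, hM⟩ := (hA.insert 0).bddAbove_image hw.abs.continuousOn
    obtain ⟨r, hr⟩ := exists_nat_ge M
    refine ⟨r, fun y => ?_⟩
    by_cases hy : y ∈ insert 0 A
    · have := hM (mem_image_of_mem _ hy)
      have h0 : 0 ≤ ‖y‖ / ((j : ℝ) + 1) := by positivity
      linarith
    · rw [mem_insert_iff, not_or] at hy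
      have hpos : 0 < ‖y‖ := norm_pos_iff.2 hy.1
      have := hAc hy.2
      change |w y / ‖y‖| < _ at this
      rw [abs_div, abs_norm, div_lt_iff₀ hpos] at this
      have h0 : (0 : ℝ) ≤ r := Nat.cast_nonneg r
      have h2 : 1 / ((j : ℝ) + 1) * ‖y‖ = ‖y‖ / ((j : ℝ) + 1) := by ring
      linarith
  · intro h
    rw [Metric.tendsto_nhds]
    intro ε hε
    obtain ⟨j, hj⟩ := exists_nat_one_div_lt (half_pos hε)
    obtain ⟨r, hr⟩ := h j
    filter_upwards [tendsto_norm_cocompact_atTop.eventually_gt_atTop (2 * r / ε)] with y hy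
    have hpos : 0 < ‖y‖ := lt_of_le_of_lt (by positivity) hy
    rw [dist_zero_right, Real.norm_eq_abs, abs_div, abs_norm, div_lt_iff₀ hpos]
    rw [div_lt_iff₀ hε] at hy
    have h2 : ‖y‖ / ((j : ℝ) + 1) = 1 / ((j : ℝ) + 1) * ‖y‖ := by ring
    have h3 : 1 / ((j : ℝ) + 1) * ‖y‖ ≤ ε / 2 * ‖y‖ := by gcongr
    have := hr y
    linarith

theorem gradient_comp_add_right {n : ℕ} (w : Ed n → ℝ) (y z : Ed n) :
    gradient (fun x => w (x + z)) y = gradient w (y + z) := by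
  simp only [gradient, fderiv_comp_add_right]

theorem mem_effSetR_iff {n : ℕ} {Ω : Type*} (H : Ed n → Ed n → Ω → ℝ) (ω : Ω) (p : Ed n)
    (μ : ℝ) : μ ∈ effSetR H ω p ↔ ∃ K : ℕ, ∃ w : lipFamily n K,
      (∀ᵐ y, H (p + gradient w.1 y) y ω ≤ μ) ∧ ∀ j, ∃ r, w ∈ growthSet n K j r := by
  constructor
  · rintro ⟨w, ⟨K, hK⟩, ht, hs⟩
    have hg := (tendsto_div_norm_iff_growth hK.continuous).1 ht
    obtain ⟨r, hr⟩ := hg 0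
    obtain ⟨N, hN⟩ := exists_nat_ge (max K r)
    have hKN : K ≤ N := (le_max_left _ _).trans hN
    have hrN : (r : ℝ≥0) ≤ N := (le_max_right _ _).trans hN
    refine ⟨N, ⟨⟨w, hK.continuous⟩, hK.weaken hKN, fun y => ?_⟩, hs, hg⟩
    refine (hr y).trans ?_
    have : (r : ℝ) ≤ N := by exact_mod_cast hrN
    simpa using this
  · rintro ⟨K, w, hs, hg⟩
    exact ⟨w.1, ⟨K, w.2.1⟩, (tendsto_div_norm_iff_growth w.1.continuous).2 hg, hs⟩

/-- Being an admissible level satisfies a zero-one law with respect to the outer measure. -/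
theorem mem_effSetR_zero_one {n : ℕ} {Ω : Type*} [MeasurableSpace Ω] (P : Measure Ω)
    [IsProbabilityMeasure P] (τ : Ed n → Ω → Ω)
    (hτgrp : ∀ y z, τ (y + z) = τ y ∘ τ z) (hτ0 : τ 0 = id)
    (herg : ∀ D : Set Ω, MeasurableSet D → (∀ z, τ z ⁻¹' D = D) → P D = 0 ∨ P D = 1)
    (H : Ed n → Ed n → Ω → ℝ)
    (hHmeas : ∀ p, Measurable (fun q : Ed n × Ω => H p q.1 q.2))
    (hHstat : ∀ p y z ω, H p y (τ z ω) = H p (y + z) ω)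
    (hHconv : ∀ y ω, ConvexOn ℝ Set.univ (fun p => H p y ω))
    (hHequi : ∀ R > (0 : ℝ), ∀ ε > (0 : ℝ), ∃ δ > (0 : ℝ), ∀ (ω : Ω) (p₁ p₂ y₁ y₂ : Ed n),
      ‖p₁‖ < R → ‖p₂‖ < R → dist p₁ p₂ < δ → dist y₁ y₂ < δ →
      |H p₁ y₁ ω - H p₂ y₂ ω| ≤ ε) (p : Ed n) (μ : ℝ) :
    ∃ S : Set Ω, MeasurableSet S ∧ P S = 1 ∧
      ((∀ ω ∈ S, μ ∈ effSetR H ω p) ∨ (∀ ω ∈ S, μ ∉ effSetR H ω p)) := by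
  by_cases h0 : P {ω | μ ∈ effSetR H ω p} = 0
  · refine ⟨(toMeasurable P {ω | μ ∈ effSetR H ω p})ᶜ, (measurableSet_toMeasurable _ _).compl,
      ?_, Or.inr fun ω hω hmem => hω (subset_toMeasurable _ _ hmem)⟩
    rw [prob_compl_eq_one_iff (measurableSet_toMeasurable _ _), measure_toMeasurable, h0]
  · let S : (K : ℕ) → Ω → Set (lipFamily n K) := fun K ω =>
      {w | ∀ᵐ y, H (p + gradient w.1 y) y ω ≤ μ}
    have hU : {ω | μ ∈ effSetR H ω p} =
        ⋃ K : ℕ, {ω | ∃ w ∈ S K ω, ∀ j, ∃ r, w ∈ growthSet n K j r} := by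
      ext ω
      rw [mem_iUnion]
      exact mem_effSetR_iff H ω p μ
    obtain ⟨K, hK⟩ : ∃ K : ℕ, P {ω | ∃ w ∈ S K ω, ∀ j, ∃ r, w ∈ growthSet n K j r} ≠ 0 := by
      by_contra! hcon
      exact h0 (by rw [hU, measure_iUnion_null hcon])
    obtain ⟨c, hc0, hc⟩ := exists_between (pos_iff_ne_zero.2 hK)
    have hS : ∀ ω, IsClosed (S K ω) := by
      intro ω
      obtain ⟨Φ, -, hΦc, hΦ⟩ :=
        exists_subsolution_constraints H hHmeas hHconv hHequi p μ (K : ℝ≥0)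
      simp only [S, hΦ, ofPred_forall]
      exact isClosed_iInter fun i => isClosed_le (hΦc i ω) continuous_const
    obtain ⟨R, hR⟩ := exists_seq_le_measure P (S K) hS (growthSet n K)
      (isClosed_growthSet n K) (monotone_growthSet n K) (fun R k =>
        measurableSet_exists_subsolution H hHmeas hHconv hHequi p μ K {j | j < k} R) hc
    let E : ℕ → Set Ω := fun M => {ω | ∃ w ∈ S (K + M) ω, ∀ j ∈ (univ : Set ℕ),
      w ∈ growthSet n ((K + M : ℕ) : ℝ≥0) j (R j + M)}
    have hEm : MeasurableSet (⋃ M, E M) := MeasurableSet.iUnion fun M =>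
      measurableSet_exists_subsolution H hHmeas hHconv hHequi p μ ((K + M : ℕ) : ℝ≥0) univ
        fun j => R j + M
    have hshift : ∀ z ω, ω ∈ ⋃ M, E M → τ z ω ∈ ⋃ M, E M := by
      intro z ω hω
      obtain ⟨M, w, hw, hwg⟩ := mem_iUnion.1 hω
      obtain ⟨N, hN⟩ := exists_nat_ge ‖z‖
      have hzn : ∀ y : Ed n, ‖y + z‖ ≤ ‖y‖ + N := fun y => (norm_add_le _ _).trans (by gcongr)
      have hKN : ((K + M : ℕ) : ℝ≥0) ≤ ((K + (M + N) : ℕ) : ℝ≥0) := by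
        exact_mod_cast (by omega)
      let v : C(Ed n, ℝ) := ⟨fun y => w.1 (y + z), by fun_prop⟩
      have hv : v ∈ lipFamily n ((K + (M + N) : ℕ) : ℝ≥0) := by
        constructor
        · refine LipschitzWith.weaken (LipschitzWith.of_dist_le_mul fun x y => ?_) hKN
          have := w.2.1.dist_le_mul (x + z) (y + z)
          rw [dist_add_right] at this
          exact this
        · intro y
          have h1 := w.2.2 (y + z)
          have h2 := hzn y
          change |w.1 (y + z)| ≤ _
          push_cast at h1 ⊢
          linarith
      refine mem_iUnion.2 ⟨M + N, ⟨v, hv⟩, ?_, fun j _ y => ?_⟩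
      · have hq := (measurePreserving_add_right (volume : Measure (Ed n)) z).quasiMeasurePreserving
        have := hq.ae hw
        filter_upwards [this] with y hy
        rw [hHstat]
        change H (p + gradient (fun x => w.1 (x + z)) y) (y + z) ω ≤ μ
        rwa [gradient_comp_add_right]
      · have h1 := hwg j (mem_univ j) (y + z)
        change |w.1 (y + z)| ≤ _
        have h2 : ‖y + z‖ / ((j : ℝ) + 1) ≤ ‖y‖ / ((j : ℝ) + 1) + N := by
          calc ‖y + z‖ / ((j : ℝ) + 1) ≤ (‖y‖ + N) / ((j : ℝ) + 1) := by gcongr; exact hzn y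
            _ = ‖y‖ / ((j : ℝ) + 1) + N / ((j : ℝ) + 1) := add_div _ _ _
            _ ≤ _ := by
              gcongr
              exact div_le_self (Nat.cast_nonneg N) (by linarith [Nat.cast_nonneg (α := ℝ) j])
        push_cast at h1 ⊢
        linarith
    have hinv : ∀ z, τ z ⁻¹' (⋃ M, E M) = ⋃ M, E M := by
      intro z
      refine Subset.antisymm (fun ω hω => ?_) fun ω hω => hshift z ω hω
      have h1 : τ (-z) (τ z ω) = ω := by
        rw [← Function.comp_apply (f := τ (-z)), ← hτgrp, neg_add_cancel, hτ0, id]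
      rw [← h1]
      exact hshift (-z) _ hω
    have hpos : P (⋃ M, E M) ≠ 0 := by
      refine (hc0.trans_le (hR.trans (measure_mono ?_))).ne'
      rintro ω ⟨w, hw, hwg⟩
      exact mem_iUnion.2 ⟨0, w, hw, fun j _ => hwg j⟩
    refine ⟨⋃ M, E M, hEm, (herg _ hEm hinv).resolve_left hpos, Or.inl fun ω hω => ?_⟩
    obtain ⟨M, w, hw, hwg⟩ := mem_iUnion.1 hω
    exact (mem_effSetR_iff H ω p μ).2 ⟨K + M, w, hw, fun j => ⟨_, hwg j (mem_univ j)⟩⟩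

theorem effSetR_nonempty {n : ℕ} {Ω : Type*} {H : Ed n → Ed n → Ω → ℝ} {ω : Ω}
    (hHbdd : ∀ R > (0 : ℝ), ∃ C : ℝ, ∀ p y, ‖p‖ < R → |H p y ω| ≤ C) (p : Ed n) :
    (effSetR H ω p).Nonempty := by
  obtain ⟨C, hC⟩ := hHbdd (‖p‖ + 1) (by positivity)
  refine ⟨C, fun _ => 0, ⟨0, LipschitzWith.const 0⟩, by simp [tendsto_const_nhds], Eventually.of_forall fun y => ?_⟩
  rw [gradient_fun_const, add_zero]
  exact (le_abs_self _).trans (hC p y (by linarith))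

theorem effSetR_bddBelow {n : ℕ} {Ω : Type*} {H : Ed n → Ed n → Ω → ℝ} {ω : Ω}
    (hHcoer : ∀ C : ℝ, ∃ R : ℝ, ∀ p y, R ≤ ‖p‖ → C ≤ H p y ω)
    (hHbdd : ∀ R > (0 : ℝ), ∃ C : ℝ, ∀ p y, ‖p‖ < R → |H p y ω| ≤ C) (p : Ed n) :
    BddBelow (effSetR H ω p) := by
  obtain ⟨R, hR⟩ := hHcoer 0
  obtain ⟨C, hC⟩ := hHbdd (max R 1) (by positivity)
  refine ⟨min 0 (-C), ?_⟩
  rintro μ ⟨w, -, -, hw⟩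
  obtain ⟨y, hy⟩ := hw.exists
  refine le_trans ?_ hy
  rcases le_or_gt R ‖p + gradient w y‖ with h | h
  · exact (min_le_left _ _).trans (hR _ y h)
  · exact (min_le_right _ _).trans (abs_le.1 (hC _ y (h.trans_le (le_max_left _ _)))).1

theorem effSetR_mono {n : ℕ} {Ω : Type*} {H : Ed n → Ed n → Ω → ℝ} {ω : Ω} {p : Ed n} {a b : ℝ}
    (ha : a ∈ effSetR H ω p) (hab : a ≤ b) : b ∈ effSetR H ω p := by
  obtain ⟨w, hK, ht, hw⟩ := ha
  exact ⟨w, hK, ht, hw.mono fun y hy => hy.trans hab⟩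

theorem effSetR_convexCombination {n : ℕ} {Ω : Type*} {H : Ed n → Ed n → Ω → ℝ} {ω : Ω}
    (hHconv : ∀ y, ConvexOn ℝ Set.univ (fun p => H p y ω)) {p q : Ed n} {a b s t : ℝ}
    (ha : a ∈ effSetR H ω p) (hb : b ∈ effSetR H ω q) (hs : 0 ≤ s) (ht : 0 ≤ t)
    (hst : s + t = 1) : s * a + t * b ∈ effSetR H ω (s • p + t • q) := by
  obtain ⟨v, ⟨K, hK⟩, hvt, hv⟩ := ha
  obtain ⟨w, ⟨L, hL⟩, hwt, hw⟩ := hb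
  refine ⟨fun y => s • v y + t • w y,
    ⟨_, ((lipschitzWith_smul s).comp hK).add ((lipschitzWith_smul t).comp hL)⟩, ?_, ?_⟩
  · have := (hvt.const_mul s).add (hwt.const_mul t)
    rw [mul_zero, mul_zero, add_zero] at this
    refine this.congr fun y => ?_
    simp only [smul_eq_mul]
    ring
  · filter_upwards [hv, hw, hK.ae_differentiableAt, hL.ae_differentiableAt] with y hvy hwy hdv hdw
    have hg : gradient (fun y => s • v y + t • w y) y = s • gradient v y + t • gradient w y := by
      simp only [gradient]
      rw [fderiv_fun_add (hdv.fun_const_smul s) (hdw.fun_const_smul t), fderiv_fun_const_smul hdv,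
        fderiv_fun_const_smul hdw, map_add, map_smul, map_smul]
    have h1 : s • p + t • q + (s • gradient v y + t • gradient w y) =
        s • (p + gradient v y) + t • (q + gradient w y) := by
      simp only [smul_add]
      abel
    rw [hg, h1]
    have := (hHconv y).2 (mem_univ (p + gradient v y)) (mem_univ (q + gradient w y)) hs ht hst
    simp only [smul_eq_mul] at this
    exact this.trans (by gcongr)

theorem continuous_effHR {n : ℕ} {Ω : Type*} {H : Ed n → Ed n → Ω → ℝ} {ω : Ω}
    (hHconv : ∀ y, ConvexOn ℝ Set.univ (fun p => H p y ω))
    (hHcoer : ∀ C : ℝ, ∃ R : ℝ, ∀ p y, R ≤ ‖p‖ → C ≤ H p y ω)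
    (hHbdd : ∀ R > (0 : ℝ), ∃ C : ℝ, ∀ p y, ‖p‖ < R → |H p y ω| ≤ C) :
    Continuous (effHR H ω) := by
  have hconv : ConvexOn ℝ univ (effHR H ω) := by
    refine ⟨convex_univ, fun p _ q _ s t hs ht hst => le_of_forall_pos_le_add fun ε hε => ?_⟩
    obtain ⟨a, ha, hal⟩ := exists_lt_of_csInf_lt (effSetR_nonempty hHbdd p)
      (lt_add_of_pos_right (effHR H ω p) hε)
    obtain ⟨b, hb, hbl⟩ := exists_lt_of_csInf_lt (effSetR_nonempty hHbdd q)
      (lt_add_of_pos_right (effHR H ω q) hε)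
    refine (csInf_le (effSetR_bddBelow hHcoer hHbdd _)
      (effSetR_convexCombination hHconv ha hb hs ht hst)).trans ?_
    calc s * a + t * b ≤ s * (effHR H ω p + ε) + t * (effHR H ω q + ε) := by gcongr
      _ = s • effHR H ω p + t • effHR H ω q + (s + t) * ε := by
        simp only [smul_eq_mul]
        ring
      _ = _ := by rw [hst, one_mul]
  exact continuousOn_univ.1 (hconv.continuousOn isOpen_univ)

theorem effHR_le_of_rat_mem {n : ℕ} {Ω : Type*} {H : Ed n → Ed n → Ω → ℝ} {ω ω' : Ω} {p : Ed n}
    (hbdd : BddBelow (effSetR H ω p)) (hne : (effSetR H ω' p).Nonempty)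
    (h : ∀ r : ℚ, (r : ℝ) ∈ effSetR H ω' p → (r : ℝ) ∈ effSetR H ω p) :
    effHR H ω p ≤ effHR H ω' p := by
  refine le_of_forall_gt fun c hc => ?_
  obtain ⟨b, hb, hbc⟩ := exists_lt_of_csInf_lt hne hc
  obtain ⟨r, hbr, hrc⟩ := exists_rat_btwn hbc
  exact (csInf_le hbdd (h r (effSetR_mono hb hbr.le))).trans_lt hrc

/-- In a stationary ergodic environment, the effective Hamiltonian is almost surely a
deterministic function of `p`. -/
theorem stmt_2
    (n : ℕ) (hn : 1 ≤ n)
    {Ω : Type*} [MeasurableSpace Ω] (P : Measure Ω) [IsProbabilityMeasure P]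
    (τ : Ed n → Ω → Ω)
    (hτmeas : ∀ y, Measurable (τ y))
    (hτmp : ∀ y, MeasurePreserving (τ y) P P)
    (hτgrp : ∀ y z, τ (y + z) = τ y ∘ τ z) (hτ0 : τ 0 = id)
    (herg : ∀ D : Set Ω, MeasurableSet D → (∀ z, τ z ⁻¹' D = D) → P D = 0 ∨ P D = 1)
    (H : Ed n → Ed n → Ω → ℝ)
    (hHmeas : ∀ p, Measurable (fun q : Ed n × Ω => H p q.1 q.2))
    (hHstat : ∀ p y z ω, H p y (τ z ω) = H p (y + z) ω)
    (hHconv : ∀ y ω, ConvexOn ℝ Set.univ (fun p => H p y ω))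
    (hHcoer : ∀ ω, ∀ C : ℝ, ∃ R : ℝ, ∀ p y, R ≤ ‖p‖ → C ≤ H p y ω)
    (hHbdd : ∀ R > (0 : ℝ), ∃ C : ℝ, ∀ ω p y, ‖p‖ < R → |H p y ω| ≤ C)
    (hHequi : ∀ R > (0 : ℝ), ∀ ε > (0 : ℝ), ∃ δ > (0 : ℝ), ∀ (ω : Ω) (p₁ p₂ y₁ y₂ : Ed n),
      ‖p₁‖ < R → ‖p₂‖ < R → dist p₁ p₂ < δ → dist y₁ y₂ < δ →
      |H p₁ y₁ ω - H p₂ y₂ ω| ≤ ε) :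
    ∃ Hbar : Ed n → ℝ, ∃ Ω₁ : Set Ω, MeasurableSet Ω₁ ∧ P Ω₁ = 1 ∧
      ∀ ω ∈ Ω₁, ∀ p : Ed n, effHR H ω p = Hbar p := by
  have hcoer : ∀ ω, ∀ C : ℝ, ∃ R : ℝ, ∀ p y, R ≤ ‖p‖ → C ≤ H p y ω := hHcoer
  have hbdd : ∀ ω, ∀ R > (0 : ℝ), ∃ C : ℝ, ∀ p y, ‖p‖ < R → |H p y ω| ≤ C := fun ω R hR => by
    obtain ⟨C, hC⟩ := hHbdd R hR
    exact ⟨C, hC ω⟩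
  choose S hSm hS1 hS using fun i : ℕ × ℚ =>
    mem_effSetR_zero_one P τ hτgrp hτ0 herg H hHmeas hHstat hHconv hHequi
      (TopologicalSpace.denseSeq (Ed n) i.1) (i.2 : ℝ)
  have hI : P (⋂ i, S i) = 1 := by
    rw [← prob_compl_eq_zero_iff (MeasurableSet.iInter hSm), compl_iInter]
    exact measure_iUnion_null fun i => (prob_compl_eq_zero_iff (hSm i)).2 (hS1 i)
  obtain ⟨ω₀, hω₀⟩ : (⋂ i, S i).Nonempty := nonempty_of_measure_ne_zero (by rw [hI]; simp)
  refine ⟨effHR H ω₀, ⋂ i, S i, MeasurableSet.iInter hSm, hI, fun ω hω => congr_fun ?_⟩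
  have hiff : ∀ k (r : ℚ), (r : ℝ) ∈ effSetR H ω (TopologicalSpace.denseSeq (Ed n) k) ↔
      (r : ℝ) ∈ effSetR H ω₀ (TopologicalSpace.denseSeq (Ed n) k) := by
    intro k r
    have h1 := mem_iInter.1 hω (k, r)
    have h2 := mem_iInter.1 hω₀ (k, r)
    rcases hS (k, r) with h | h
    · exact iff_of_true (h ω h1) (h ω₀ h2)
    · exact iff_of_false (h ω h1) (h ω₀ h2)
  refine (TopologicalSpace.denseRange_denseSeq (Ed n)).equalizer
    (continuous_effHR (fun y => hHconv y ω) (hcoer ω) (hbdd ω))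
    (continuous_effHR (fun y => hHconv y ω₀) (hcoer ω₀) (hbdd ω₀)) (funext fun k => ?_)
  exact le_antisymm
    (effHR_le_of_rat_mem (effSetR_bddBelow (hcoer ω) (hbdd ω) _)
      (effSetR_nonempty (hbdd ω₀) _) fun r => (hiff k r).2)
    (effHR_le_of_rat_mem (effSetR_bddBelow (hcoer ω₀) (hbdd ω₀) _)
      (effSetR_nonempty (hbdd ω) _) fun r => (hiff k r).1)

end
end

section
/- Almost surely in ω, for every p ∈ ℝⁿ: essinf_{ω'∈Ω} H(p,0,ω') ≤ \overline{H}(p,ω) ≤ esssup_{ω'∈Ω} H(p,0,ω'). -/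
open MeasureTheory Filter Metric Set
open scoped NNReal

noncomputable section

/-- The average of a Lipschitz function against translates of an absolutely continuous probability
measure with bounded support is differentiable everywhere, and its derivative is the average of the
derivatives. -/
lemma LipschitzWith.hasFDerivAt_integral_add {E : Type*} [NormedAddCommGroup E] [NormedSpace ℝ E]
    [FiniteDimensional ℝ E] [MeasurableSpace E] [BorelSpace E] {vol : Measure E}
    [vol.IsAddHaarMeasure] {ν : Measure E} [IsProbabilityMeasure ν] (hν : ν ≪ vol) {η : ℝ}
    (hη : ∀ᵐ z ∂ν, ‖z‖ ≤ η) {K : ℝ≥0} {w : E → ℝ} (hw : LipschitzWith K w) (y : E) :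
    Integrable (fun z => fderiv ℝ w (y + z)) ν ∧
      HasFDerivAt (fun x => ∫ z, w (x + z) ∂ν) (∫ z, fderiv ℝ w (y + z) ∂ν) y := by
  have hcont : ∀ x, Continuous fun z => w (x + z) := fun x =>
    hw.continuous.comp (continuous_const.add continuous_id)
  refine hasFDerivAt_integral_of_dominated_loc_of_lip (F := fun x z => w (x + z))
    (bound := fun _ => (K : ℝ)) (s := Set.univ) Filter.univ_mem
    (Eventually.of_forall fun x => (hcont x).aestronglyMeasurable) ?_ ?_ ?_ (integrable_const _) ?_
  · refine Integrable.of_bound (hcont y).aestronglyMeasurable (‖w y‖ + K * η) ?_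
    filter_upwards [hη] with z hz
    have h := hw.norm_sub_le (y + z) y
    have h' : ‖w (y + z)‖ ≤ ‖w (y + z) - w y‖ + ‖w y‖ := by
      simpa using norm_add_le (w (y + z) - w y) (w y)
    have : (K : ℝ) * ‖z‖ ≤ K * η := by gcongr
    rw [add_sub_cancel_left] at h
    linarith
  · exact ((measurable_fderiv ℝ w).comp (measurable_const_add y)).aestronglyMeasurable
  · refine Eventually.of_forall fun z => ?_
    rw [Real.nnabs_of_nonneg K.coe_nonneg, Real.toNNReal_coe]
    refine (LipschitzWith.of_dist_le_mul fun a b => ?_).lipschitzOnWith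
    simpa using hw.dist_le_mul (a + z) (b + z)
  · have h : ∀ᵐ z ∂vol, DifferentiableAt ℝ w (y + z) :=
      (measurePreserving_add_left vol y).quasiMeasurePreserving.ae hw.ae_differentiableAt
    filter_upwards [hν.ae_le h] with z hz
    exact (hasFDerivAt_comp_add_right z).2 hz.hasFDerivAt

/-- If the increments of `f` at `x` are at most `δ` times the norm of the displacement, then the
derivative of `f` at `x` has norm at most `δ`. -/
lemma HasFDerivAt.norm_le_of_sub_le {E : Type*} [NormedAddCommGroup E] [NormedSpace ℝ E]
    {f : E → ℝ} {L : E →L[ℝ] ℝ} {x : E} {δ : ℝ} (hδ : 0 ≤ δ) (hf : HasFDerivAt f L x)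
    (h : ∀ v, f (x + v) - f x ≤ δ * ‖v‖) : ‖L‖ ≤ δ := by
  have key : ∀ v, L v ≤ δ * ‖v‖ := by
    intro v
    have hd : HasDerivAt (fun t : ℝ => f (x + t • v)) (L v) 0 := hf.hasLineDerivAt v
    refine le_of_tendsto hd.tendsto_slope_zero_right ?_
    filter_upwards [self_mem_nhdsWithin] with t ht
    have ht : 0 < t := ht
    have h1 := h (t • v)
    rw [norm_smul, Real.norm_of_nonneg ht.le] at h1
    simp only [zero_add, zero_smul, add_zero, smul_eq_mul]
    rw [inv_mul_le_iff₀ ht]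
    linarith
  refine L.opNorm_le_bound hδ fun v => abs_le.2 ⟨?_, key v⟩
  have := key (-v)
  rw [map_neg, norm_neg] at this
  linarith

/-- A continuous sublinear function has a point at which its increments are at most `δ` times the
norm of the displacement. -/
lemma exists_forall_sub_le_mul_norm {E : Type*} [NormedAddCommGroup E] [NormedSpace ℝ E]
    {f : E → ℝ} (hf : Continuous f) {w : E → ℝ} {C : ℝ} (hfw : ∀ y, f y ≤ w y + C)
    [ProperSpace E]
    (hw : Tendsto (fun y => w y / ‖y‖) (cocompact E) (nhds 0)) {δ : ℝ} (hδ : 0 < δ) :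
    ∃ x, ∀ v, f (x + v) - f x ≤ δ * ‖v‖ := by
  have hev : ∀ᶠ y in cocompact E, f y - δ * ‖y‖ ≤ f 0 - δ * ‖(0 : E)‖ := by
    have hnorm := tendsto_norm_cocompact_atTop (E := E)
    filter_upwards [hw.eventually (gt_mem_nhds (half_pos hδ)), hnorm.eventually_gt_atTop 0,
      hnorm.eventually_ge_atTop ((C - f 0) / (δ / 2))] with y h1 h2 h3
    rw [div_lt_iff₀ h2] at h1
    rw [div_le_iff₀ (half_pos hδ)] at h3
    have := hfw y
    rw [norm_zero]
    linarith
  obtain ⟨x, hx⟩ := Continuous.exists_forall_ge' (f := fun y => f y - δ * ‖y‖)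
    (by fun_prop) 0 hev
  refine ⟨x, fun v => ?_⟩
  have h1 := hx (x + v)
  have h2 : δ * ‖x + v‖ ≤ δ * (‖x‖ + ‖v‖) := by gcongr; exact norm_add_le x v
  linarith

/-- Every admissible level at `p` is at least any lower bound of `H p · ω`. -/
lemma le_of_mem_effSetR {n : ℕ} {Ω : Type*} {H : Ed n → Ed n → Ω → ℝ} {ω : Ω} {p : Ed n}
    (hHconv : ∀ y, ConvexOn ℝ Set.univ (fun p => H p y ω))
    (hHequi : ∀ R > (0 : ℝ), ∀ ε > (0 : ℝ), ∃ δ > (0 : ℝ), ∀ p₁ p₂ y₁ y₂ : Ed n,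
      ‖p₁‖ < R → ‖p₂‖ < R → dist p₁ p₂ < δ → dist y₁ y₂ < δ →
      |H p₁ y₁ ω - H p₂ y₂ ω| ≤ ε)
    {m : ℝ} (hm : ∀ y, m ≤ H p y ω) {c : ℝ} (hc : c ∈ effSetR H ω p) : m ≤ c := by
  obtain ⟨w, ⟨K, hK⟩, hsub, hle⟩ := hc
  refine le_of_forall_pos_le_add fun ε hε => ?_
  obtain ⟨η, hη, hequi⟩ := hHequi (‖p‖ + K + 1) (by positivity) (ε / 2) (half_pos hε)
  let ν : Measure (Ed n) := ProbabilityTheory.cond volume (ball 0 η)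
  have : IsProbabilityMeasure ν := ProbabilityTheory.cond_isProbabilityMeasure_of_finite
    (measure_ball_pos _ _ hη).ne' measure_ball_lt_top.ne
  have hν : ν ≪ volume := ProbabilityTheory.cond_absolutelyContinuous
  have hball : ∀ᵐ z ∂ν, ‖z‖ < η := by
    filter_upwards [ProbabilityTheory.ae_cond_mem (μ := volume) measurableSet_ball] with z hz
    simpa using hz
  have hball' : ∀ᵐ z ∂ν, ‖z‖ ≤ η := hball.mono fun z hz => hz.le
  have hder := hK.hasFDerivAt_integral_add hν hball'
  set W : Ed n → ℝ := fun x => ∫ z, w (x + z) ∂ν with hWdef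
  have hWw : ∀ y, W y ≤ w y + K * η := by
    intro y
    have hbd : ∀ᵐ z ∂ν, w (y + z) ∈ Set.Icc (w y - K * η) (w y + K * η) := by
      filter_upwards [hball'] with z hz
      have h := hK.norm_sub_le (y + z) y
      rw [add_sub_cancel_left, Real.norm_eq_abs] at h
      have h2 : (K : ℝ) * ‖z‖ ≤ K * η := by gcongr
      obtain ⟨h3, h4⟩ := abs_le.1 h
      constructor <;> linarith
    have hcont : Continuous fun z => w (y + z) :=
      hK.continuous.comp (continuous_const.add continuous_id)
    exact ((convex_Icc _ _).integral_mem isClosed_Icc hbd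
      (Integrable.of_mem_Icc _ _ hcont.measurable.aemeasurable hbd)).2
  have hWcont : Continuous W := continuous_iff_continuousAt.2 fun y => (hder y).2.continuousAt
  obtain ⟨y, hy⟩ := exists_forall_sub_le_mul_norm hWcont hWw hsub
    (lt_min (half_pos hη) one_half_pos)
  obtain ⟨hint, hfd⟩ := hder y
  have hnorm := hfd.norm_le_of_sub_le (lt_min (half_pos hη) one_half_pos).le hy
  set L := ∫ z, fderiv ℝ w (y + z) ∂ν
  let J := (InnerProductSpace.toDual ℝ (Ed n)).symm
  have hJ : ‖J L‖ = ‖L‖ := J.norm_map L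
  have hcontH : Continuous fun q => H q y ω := (hHconv y).locallyLipschitz.continuous
  have hmem : L ∈ {l : StrongDual ℝ (Ed n) | H (p + J l) y ω ≤ c + ε / 2} := by
    refine Convex.integral_mem ?_ ?_ ?_ hint
    · intro a ha b hb s t hs ht hst
      have h := (hHconv y).2 (Set.mem_univ (p + J a)) (Set.mem_univ (p + J b)) hs ht hst
      have heq : s • (p + J a) + t • (p + J b) = p + J (s • a + t • b) := by
        have : J (s • a + t • b) = s • J a + t • J b := by simp [J]
        rw [this, smul_add, smul_add, add_add_add_comm, ← add_smul, hst, one_smul]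
      simp only [heq, smul_eq_mul] at h
      have ha : H (p + J a) y ω ≤ c + ε / 2 := ha
      have hb : H (p + J b) y ω ≤ c + ε / 2 := hb
      refine h.trans ?_
      calc s * H (p + J a) y ω + t * H (p + J b) y ω
          ≤ s * (c + ε / 2) + t * (c + ε / 2) := by gcongr
        _ = c + ε / 2 := by rw [← add_mul, hst, one_mul]
    · exact isClosed_le (hcontH.comp (continuous_const.add J.continuous)) continuous_const
    · have h : ∀ᵐ z ∂(volume : Measure (Ed n)), H (p + gradient w (y + z)) (y + z) ω ≤ c :=
        (measurePreserving_add_left volume y).quasiMeasurePreserving.ae hle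
      filter_upwards [hν.ae_le h, hball] with z hz hzη
      have hg : ‖p + gradient w (y + z)‖ < ‖p‖ + K + 1 := by
        have h1 : ‖gradient w (y + z)‖ ≤ K := by
          rw [gradient, LinearIsometryEquiv.norm_map]
          exact norm_fderiv_le_of_lipschitz ℝ hK
        have h2 := norm_add_le p (gradient w (y + z))
        linarith
      have h3 := (abs_le.1 (hequi _ _ y (y + z) hg hg (by rwa [dist_self])
        (by rwa [dist_self_add_right]))).2
      change H (p + gradient w (y + z)) y ω ≤ c + ε / 2
      linarith
  have hmem : H (p + J L) y ω ≤ c + ε / 2 := hmem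
  have hK0 : (0 : ℝ) ≤ K := K.coe_nonneg
  have hL1 : ‖L‖ ≤ η / 2 := hnorm.trans (min_le_left _ _)
  have hL2 : ‖L‖ ≤ 1 / 2 := hnorm.trans (min_le_right _ _)
  have h1 := norm_add_le p (J L)
  have h2 := (abs_le.1 (hequi p (p + J L) y y (by linarith) (by linarith)
    (by rw [dist_self_add_right]; linarith) (by rwa [dist_self]))).2
  have := hm y
  linarith

/-- Almost surely, the Hamiltonian lies between its essential infimum and supremum for all momenta
and positions simultaneously. -/
lemma ae_forall_mem_Icc_essInf_essSup {E Ω : Type*} [NormedAddCommGroup E]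
    [TopologicalSpace.SeparableSpace E] [MeasurableSpace Ω] {P : Measure Ω}
    [IsProbabilityMeasure P] {τ : E → Ω → Ω} (hτmp : ∀ y, MeasurePreserving (τ y) P P)
    {H : E → E → Ω → ℝ} (hHstat : ∀ p y z ω, H p y (τ z ω) = H p (y + z) ω)
    (hHbdd : ∀ R > (0 : ℝ), ∃ C : ℝ, ∀ ω p y, ‖p‖ < R → |H p y ω| ≤ C)
    (hHequi : ∀ R > (0 : ℝ), ∀ ε > (0 : ℝ), ∃ δ > (0 : ℝ), ∀ (ω : Ω) (p₁ p₂ y₁ y₂ : E),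
      ‖p₁‖ < R → ‖p₂‖ < R → dist p₁ p₂ < δ → dist y₁ y₂ < δ →
      |H p₁ y₁ ω - H p₂ y₂ ω| ≤ ε) :
    ∀ᵐ ω ∂P, ∀ p y, H p y ω ∈ Set.Icc (essInf (fun ω' => H p 0 ω') P)
      (essSup (fun ω' => H p 0 ω') P) := by
  have hbdd : ∀ p, ∃ C, ∀ ω, |H p 0 ω| ≤ C := fun p =>
    (hHbdd (‖p‖ + 1) (by positivity)).imp fun C hC ω => hC ω p 0 (by linarith)
  have hge : ∀ p, IsBoundedUnder (· ≥ ·) (ae P) (fun ω => H p 0 ω) := fun p =>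
    isBoundedUnder_of ((hbdd p).elim fun C hC => ⟨-C, fun ω => (abs_le.1 (hC ω)).1⟩)
  have hle : ∀ p, IsBoundedUnder (· ≤ ·) (ae P) (fun ω => H p 0 ω) := fun p =>
    isBoundedUnder_of ((hbdd p).elim fun C hC => ⟨C, fun ω => (abs_le.1 (hC ω)).2⟩)
  have hpt : ∀ p y, ∀ᵐ ω ∂P, H p y ω ∈ Set.Icc (essInf (fun ω' => H p 0 ω') P)
      (essSup (fun ω' => H p 0 ω') P) := by
    intro p y
    have h : ∀ᵐ ω ∂P, H p 0 ω ∈ Set.Icc (essInf (fun ω' => H p 0 ω') P)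
        (essSup (fun ω' => H p 0 ω') P) := by
      filter_upwards [ae_essInf_le (hge p), ae_le_essSup (hle p)] with ω h1 h2
      exact ⟨h1, h2⟩
    filter_upwards [(hτmp y).quasiMeasurePreserving.ae h] with ω hω
    rwa [hHstat, zero_add] at hω
  obtain ⟨D, hDc, hD⟩ := TopologicalSpace.exists_countable_dense E
  have hall : ∀ᵐ ω ∂P, ∀ p ∈ D, ∀ y ∈ D, H p y ω ∈ Set.Icc (essInf (fun ω' => H p 0 ω') P)
      (essSup (fun ω' => H p 0 ω') P) :=
    (ae_ball_iff hDc).2 fun p _ => (ae_ball_iff hDc).2 fun y _ => hpt p y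
  filter_upwards [hall] with ω hω p y
  have key : ∀ ε > 0, essInf (fun ω' => H p 0 ω') P ≤ H p y ω + ε ∧
      H p y ω ≤ essSup (fun ω' => H p 0 ω') P + ε := by
    intro ε hε
    obtain ⟨δ, hδ, hequi⟩ := hHequi (‖p‖ + 1) (by positivity) (ε / 2) (half_pos hε)
    obtain ⟨q, hq, hpq⟩ := hD.exists_dist_lt p (lt_min hδ one_pos)
    obtain ⟨x, hx, hyx⟩ := hD.exists_dist_lt y hδ
    have hpn : ‖p‖ < ‖p‖ + 1 := by linarith
    have hqn : ‖q‖ < ‖p‖ + 1 := by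
      have h1 := hpq.trans_le (min_le_right _ _)
      rw [dist_comm, dist_eq_norm] at h1
      have h2 := norm_sub_norm_le q p
      linarith
    have hpqδ := hpq.trans_le (min_le_left _ _)
    have hinf : essInf (fun ω' => H p 0 ω') P - ε / 2 ≤ essInf (fun ω' => H q 0 ω') P := by
      refine le_liminf_of_le (hle q).isCoboundedUnder_ge ?_
      filter_upwards [ae_essInf_le (hge p)] with ω' h
      have := (abs_le.1 (hequi ω' p q 0 0 hpn hqn hpqδ (by rwa [dist_self]))).2
      linarith
    have hsup : essSup (fun ω' => H q 0 ω') P ≤ essSup (fun ω' => H p 0 ω') P + ε / 2 := by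
      refine limsup_le_of_le (hge q).isCoboundedUnder_le ?_
      filter_upwards [ae_le_essSup (hle p)] with ω' h
      have := (abs_le.1 (hequi ω' p q 0 0 hpn hqn hpqδ (by rwa [dist_self]))).1
      linarith
    obtain ⟨h1, h2⟩ := hω q hq x hx
    obtain ⟨h3, h4⟩ := abs_le.1 (hequi ω p q y x hpn hqn hpqδ hyx)
    constructor <;> linarith
  exact ⟨le_of_forall_pos_le_add fun ε hε => (key ε hε).1,
    le_of_forall_pos_le_add fun ε hε => (key ε hε).2⟩

/-- The crude two-sided bound: almost surely, for every `p`,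
`essinf_ω' H(p,0,ω') ≤ H̄(p,ω) ≤ esssup_ω' H(p,0,ω')`. -/
theorem stmt_12
    (n : ℕ) (hn : 1 ≤ n)
    {Ω : Type*} [MeasurableSpace Ω] (P : Measure Ω) [IsProbabilityMeasure P]
    (τ : Ed n → Ω → Ω)
    (hτmeas : ∀ y, Measurable (τ y))
    (hτmp : ∀ y, MeasurePreserving (τ y) P P)
    (hτgrp : ∀ y z, τ (y + z) = τ y ∘ τ z) (hτ0 : τ 0 = id)
    (herg : ∀ D : Set Ω, MeasurableSet D → (∀ z, τ z ⁻¹' D = D) → P D = 0 ∨ P D = 1)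
    (H : Ed n → Ed n → Ω → ℝ)
    (hHmeas : ∀ p, Measurable (fun q : Ed n × Ω => H p q.1 q.2))
    (hHstat : ∀ p y z ω, H p y (τ z ω) = H p (y + z) ω)
    (hHconv : ∀ y ω, ConvexOn ℝ Set.univ (fun p => H p y ω))
    (hHcoer : ∀ ω, ∀ C : ℝ, ∃ R : ℝ, ∀ p y, R ≤ ‖p‖ → C ≤ H p y ω)
    (hHbdd : ∀ R > (0 : ℝ), ∃ C : ℝ, ∀ ω p y, ‖p‖ < R → |H p y ω| ≤ C)
    (hHequi : ∀ R > (0 : ℝ), ∀ ε > (0 : ℝ), ∃ δ > (0 : ℝ), ∀ (ω : Ω) (p₁ p₂ y₁ y₂ : Ed n),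
      ‖p₁‖ < R → ‖p₂‖ < R → dist p₁ p₂ < δ → dist y₁ y₂ < δ →
      |H p₁ y₁ ω - H p₂ y₂ ω| ≤ ε) :
    ∀ᵐ ω ∂P, ∀ p : Ed n,
      essInf (fun ω' => H p 0 ω') P ≤ effHR H ω p ∧
        effHR H ω p ≤ essSup (fun ω' => H p 0 ω') P := by
  filter_upwards [ae_forall_mem_Icc_essInf_essSup hτmp hHstat hHbdd hHequi] with ω hω p
  have hlow : ∀ c ∈ effSetR H ω p, essInf (fun ω' => H p 0 ω') P ≤ c := fun c hc =>
    le_of_mem_effSetR (fun y => hHconv y ω)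
      (fun R hR ε hε => (hHequi R hR ε hε).imp fun δ hδ => ⟨hδ.1, hδ.2 ω⟩)
      (fun y => (hω p y).1) hc
  have hmem : essSup (fun ω' => H p 0 ω') P ∈ effSetR H ω p := by
    refine ⟨fun _ => 0, ⟨0, LipschitzWith.const 0⟩, by simpa using tendsto_const_nhds,
      Eventually.of_forall fun y => ?_⟩
    have hgrad : gradient (fun _ : Ed n => (0 : ℝ)) y = 0 := by simp [gradient]
    rw [hgrad, add_zero]
    exact (hω p y).2
  exact ⟨le_csInf ⟨_, hmem⟩ hlow, csInf_le ⟨_, hlow⟩ hmem⟩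

end
end

section
/- Let H : ℝⁿ × ℝⁿ → ℝ be coercive in the sense that m(R) := inf{ H(p,x) : |p| ≥ R, x ∈ ℝⁿ } → +∞ as R → ∞, and let R₀ > 0 be such that m(R₀) > 0. If U ⊆ ℝⁿ is open and convex and u : U → ℝ is locally Lipschitz with H(∇u(x), x) ≤ 0 for almost every x ∈ U, then |∇u(x)| ≤ R₀ for almost every x ∈ U and u is Lipschitz continuous on U with Lipschitz constant R₀. -/
open MeasureTheory Filter Metric Set
open scoped NNReal

noncomputable section

/-- A function that is locally Lipschitz on an open set is differentiable almost everywhere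
there. -/
theorem LocallyLipschitzOn.ae_differentiableAt {E F : Type*} [NormedAddCommGroup E]
    [NormedSpace ℝ E] [FiniteDimensional ℝ E] [MeasurableSpace E] [BorelSpace E]
    [NormedAddCommGroup F] [NormedSpace ℝ F] [FiniteDimensional ℝ F]
    {μ : Measure E} [μ.IsAddHaarMeasure] {f : E → F} {U : Set E} (hU : IsOpen U)
    (hf : LocallyLipschitzOn U f) : ∀ᵐ x ∂μ, x ∈ U → DifferentiableAt ℝ f x := by
  rw [ae_iff]
  refine measure_null_of_locally_null _ fun x hx => ?_
  have hxU : x ∈ U := by by_contra h; exact hx fun h' => absurd h' h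
  obtain ⟨K, t, ht, hK⟩ := hf hxU
  rw [hU.nhdsWithin_eq hxU] at ht
  obtain ⟨V, hVt, hV, hxV⟩ := _root_.mem_nhds_iff.1 ht
  refine ⟨V ∩ {a | ¬(a ∈ U → DifferentiableAt ℝ f a)},
    inter_mem (mem_nhdsWithin_of_mem_nhds (hV.mem_nhds hxV)) self_mem_nhdsWithin, ?_⟩
  have h := (hK.mono hVt).ae_differentiableWithinAt_of_mem (μ := μ)
  refine measure_mono_null ?_ (ae_iff.1 h)
  intro y hy h'
  exact hy.2 fun _ => (h' hy.1).differentiableAt (hV.mem_nhds hy.1)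

/-- A Lipschitz function on `[0, 1]` whose derivative is bounded by `C` almost everywhere varies
by at most `C`. -/
theorem LipschitzOnWith.abs_sub_le_of_ae_abs_deriv_le {g : ℝ → ℝ} {K : ℝ≥0} {C : ℝ}
    (hg : LipschitzOnWith K g (Icc 0 1)) (h : ∀ᵐ t : ℝ, t ∈ Icc (0 : ℝ) 1 → |deriv g t| ≤ C) :
    |g 1 - g 0| ≤ C := by
  have hac : AbsolutelyContinuousOnInterval g 0 1 := by
    refine LipschitzOnWith.absolutelyContinuousOnInterval (K := K) ?_
    rwa [uIcc_of_le zero_le_one]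
  rw [← hac.integral_deriv_eq_sub]
  simpa using intervalIntegral.norm_integral_le_of_norm_le_const_ae (a := 0) (b := 1) (f := deriv g)
    (h.mono fun t ht htI => ht (Ioc_subset_Icc_self (by simpa using htI)))

/-- On a convex open set, a locally Lipschitz function whose derivative is bounded by `C` almost
everywhere is `C`-Lipschitz. -/
theorem LocallyLipschitzOn.lipschitzOnWith_of_ae_norm_fderiv_le {E : Type*} [NormedAddCommGroup E]
    [NormedSpace ℝ E] [FiniteDimensional ℝ E] [MeasurableSpace E] [BorelSpace E]
    {μ : Measure E} [μ.IsAddHaarMeasure] {f : E → ℝ} {U : Set E} {C : ℝ≥0} (hU : IsOpen U)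
    (hUc : Convex ℝ U) (hf : LocallyLipschitzOn U f)
    (hC : ∀ᵐ x ∂μ, x ∈ U → ‖fderiv ℝ f x‖ ≤ C) : LipschitzOnWith C f U := by
  refine LipschitzOnWith.of_dist_le_mul fun y hy x hx => ?_
  set v := y - x with hv
  obtain ⟨s, hs0, hs, hsub⟩ := ((hf.ae_differentiableAt hU (μ := μ)).and hC).exists_measurable_mem
  have hline := (ae_ae_add_linearMap_mem_iff (LinearMap.toSpanSingleton ℝ E v) volume μ hs).2 hs0
  have hdense := dense_iff_closure_eq.1 (Measure.dense_of_ae hline)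
  have hbound : ∀ z, (∀ᵐ t : ℝ, z + LinearMap.toSpanSingleton ℝ E v t ∈ s) → z ∈ U → z + v ∈ U →
      |f (z + v) - f z| ≤ C * ‖v‖ := by
    intro z hz hzU hzvU
    have hmaps : MapsTo (fun t : ℝ => z + t • v) (Icc 0 1) U := fun t ht =>
      hUc.add_smul_mem hzU hzvU ht
    have hcont : LipschitzWith ‖v‖₊ (fun t : ℝ => z + t • v) :=
      LipschitzWith.of_dist_le_mul fun a b => by
        rw [dist_add_left, dist_eq_norm, ← sub_smul, norm_smul, mul_comm]; rfl
    have hcpt : IsCompact ((fun t : ℝ => z + t • v) '' Icc 0 1) :=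
      isCompact_Icc.image hcont.continuous
    obtain ⟨K, hK⟩ := (hf.mono hmaps.image_subset).exists_lipschitzOnWith_of_compact hcpt
    have hg := hK.comp (hcont.lipschitzOnWith (s := Icc 0 1)) (mapsTo_image _ _)
    have := hg.abs_sub_le_of_ae_abs_deriv_le (C := C * ‖v‖) ?_
    · simpa using this
    filter_upwards [hz] with t ht htI
    obtain ⟨hd, hb⟩ := hsub _ ht
    have htU : z + t • v ∈ U := hmaps htI
    have hder : HasDerivAt (fun t : ℝ => z + t • v) v t := by
      simpa using ((hasDerivAt_id t).smul_const v).const_add z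
    have hd' : DifferentiableAt ℝ f (z + t • v) := hd htU
    have := hd'.hasFDerivAt.comp_hasDerivAt t hder
    rw [this.deriv]
    exact ((fderiv ℝ f (z + t • v)).le_opNorm v).trans
      (mul_le_mul_of_nonneg_right (hb htU) (norm_nonneg v))
  have hyv : x + v = y := by simp [hv]
  have hfc (w) (hw : w ∈ U) : ContinuousAt f w := hf.continuousOn.continuousAt (hU.mem_nhds hw)
  have hev : ∀ᶠ z in nhds x, z ∈ U ∧ z + v ∈ U := by
    refine (hU.eventually_mem hx).and ?_
    refine (continuous_add_const v).continuousAt.eventually (hU.eventually_mem ?_)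
    simpa only [hyv] using hy
  have hfreq : ∃ᶠ z in nhds x, |f (z + v) - f z| ≤ C * ‖v‖ := by
    have hx' := mem_closure_iff_frequently.1 (hdense.symm ▸ mem_univ x)
    exact (hx'.and_eventually hev).mono fun z hz => hbound z hz.1 hz.2.1 hz.2.2
  have hlim : Tendsto (fun z => |f (z + v) - f z|) (nhds x) (nhds |f (x + v) - f x|) := by
    refine Tendsto.abs (Tendsto.sub ?_ (hfc x hx))
    refine ContinuousAt.comp (f := fun z => z + v) (g := f) ?_ (by fun_prop)
    exact hfc _ (by rwa [hyv])
  have := le_of_tendsto_of_frequently hlim hfreq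
  rwa [hyv, ← Real.dist_eq, hv, ← dist_eq_norm] at this

/-- A locally Lipschitz a.e. subsolution of `H(∇u, x) ≤ 0` with `H` coercive has gradient
bounded by `R₀` a.e. (where `inf_{|p| ≥ R₀, x} H(p,x) > 0`) and is `R₀`-Lipschitz on a
convex open set. -/
theorem stmt_15
    (n : ℕ) (hn : 1 ≤ n)
    (H : Ed n → Ed n → ℝ)
    -- coercivity: m(R) := inf { H(p,x) : |p| ≥ R } → +∞ as R → ∞
    (hcoer : ∀ C : ℝ, ∃ R : ℝ, ∀ (p x : Ed n), R ≤ ‖p‖ → C ≤ H p x)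
    (R₀ : ℝ) (hR₀pos : 0 < R₀)
    -- m(R₀) > 0
    (hR₀ : ∃ δ > (0 : ℝ), ∀ (p x : Ed n), R₀ ≤ ‖p‖ → δ ≤ H p x)
    (U : Set (Ed n)) (hU : IsOpen U) (hUconv : Convex ℝ U)
    (u : Ed n → ℝ)
    (hulip : ∀ x ∈ U, ∃ K : ℝ≥0, ∃ t ∈ nhdsWithin x U, LipschitzOnWith K u t)
    (hsub : ∀ᵐ x ∂(volume : Measure (Ed n)), x ∈ U → H (gradient u x) x ≤ 0) :
    (∀ᵐ x ∂(volume : Measure (Ed n)), x ∈ U → ‖gradient u x‖ ≤ R₀) ∧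
      LipschitzOnWith (Real.toNNReal R₀) u U := by
  obtain ⟨δ, hδ, hδH⟩ := hR₀
  have hgrad : ∀ᵐ x ∂(volume : Measure (Ed n)), x ∈ U → ‖gradient u x‖ ≤ R₀ := by
    filter_upwards [hsub] with x hx hxU
    by_contra! hlt
    exact absurd (hx hxU) (not_le.2 (hδ.trans_le (hδH _ x hlt.le)))
  refine ⟨hgrad, LocallyLipschitzOn.lipschitzOnWith_of_ae_norm_fderiv_le (μ := volume) hU hUconv
    (fun x hx => hulip x hx) ?_⟩
  filter_upwards [hgrad] with x hx hxU
  rw [Real.coe_toNNReal _ hR₀pos.le]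
  simpa [gradient] using hx hxU

end
end
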